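/- arXiv:1912.00054 — 3 statements merged into one kernel-verified Lean document; each statement's English description precedes it below -/
import Mathlib

section
/- The function u is of class C^{1,2} on [t₀,T) × ℝⁿ (once continuously differentiable in t, twice continuously differentiable in x), and for all (t,x) ∈ [t₀,T) × ℝⁿ it satisfies the linear second-order partial differential equation ∂u/∂t(t,x) = −(1/2) Σ_{j=1}^n R_j′(t) ∂²u/∂x_j²(t,x) + Σ_{j=1}^n r_j(t) ∂u/∂x_j(t,x) + A₁(t) u(t,x) + f(t). -/
open Real MeasureTheory intervalIntegral

section ExponentialFamily

universe w v

variable {Y : Type w} [MeasurableSpace Y] {F G : Type v}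
  [NormedAddCommGroup F] [NormedSpace ℝ F] [NormedAddCommGroup G] [NormedSpace ℝ G]

/-- The parameter `θ` lies in the interior of the domain of the exponential family with sufficient
statistic `S` and vector-valued density `g`. -/
def ExpIntegrableNear (μ : Measure Y) (S : Y → StrongDual ℝ F) (g : Y → G) (θ : F) : Prop :=
  AEStronglyMeasurable g μ ∧
    ∃ ε > 0, Integrable (fun y => Real.exp (S y θ + ε * ‖S y‖) * ‖g y‖) μ

/-- The Laplace transform `θ ↦ ∫ exp (S y θ) • g y` of `g` along the statistic `S`. -/
noncomputable def expIntegral (μ : Measure Y) (S : Y → StrongDual ℝ F) (g : Y → G) (θ : F) : G :=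
  ∫ y, Real.exp (S y θ) • g y ∂μ

variable {μ : Measure Y} {S : Y → StrongDual ℝ F} {g : Y → G} {θ : F}

lemma aestronglyMeasurable_exp_smul (hS : AEStronglyMeasurable S μ)
    (hg : AEStronglyMeasurable g μ) (θ : F) :
    AEStronglyMeasurable (fun y => Real.exp (S y θ) • g y) μ :=
  (Real.continuous_exp.comp_aestronglyMeasurable (hS.apply_continuousLinearMap θ)).smul hg

lemma ExpIntegrableNear.integrable (hS : AEStronglyMeasurable S μ)
    (h : ExpIntegrableNear μ S g θ) : Integrable (fun y => Real.exp (S y θ) • g y) μ := by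
  obtain ⟨hg, ε, hε, hi⟩ := h
  refine hi.mono' (aestronglyMeasurable_exp_smul hS hg θ) (Filter.Eventually.of_forall fun y => ?_)
  rw [norm_smul, Real.norm_of_nonneg (Real.exp_pos _).le]
  gcongr
  nlinarith [norm_nonneg (S y)]

omit [NormedSpace ℝ G] in
lemma ExpIntegrableNear.of_norm_le {G' : Type v} [NormedAddCommGroup G'] (hS : AEStronglyMeasurable S μ) (h : ExpIntegrableNear μ S g θ) {k : Y → G'}
    (hk : AEStronglyMeasurable k μ) {C : ℝ} (hC : 0 ≤ C) (hle : ∀ y, ‖k y‖ ≤ C * ‖S y‖ * ‖g y‖) :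
    ExpIntegrableNear μ S k θ := by
  obtain ⟨hg, ε, hε, hi⟩ := h
  refine ⟨hk, ε / 2, half_pos hε, (hi.const_mul (C * (2 / ε))).mono' ?_
    (Filter.Eventually.of_forall fun y => ?_)⟩
  · exact (Real.continuous_exp.comp_aestronglyMeasurable ((hS.apply_continuousLinearMap θ).add
      (hS.norm.const_mul _))).mul hk.norm
  · rw [norm_mul, norm_norm, Real.norm_of_nonneg (Real.exp_pos _).le]
    have h1 : ‖S y‖ ≤ 2 / ε * Real.exp (ε / 2 * ‖S y‖) := by
      have := Real.add_one_le_exp (ε / 2 * ‖S y‖)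
      calc ‖S y‖ = 2 / ε * (ε / 2 * ‖S y‖) := by field_simp
        _ ≤ _ := by gcongr; linarith
    calc Real.exp (S y θ + ε / 2 * ‖S y‖) * ‖k y‖
        ≤ Real.exp (S y θ + ε / 2 * ‖S y‖) *
            (C * (2 / ε * Real.exp (ε / 2 * ‖S y‖)) * ‖g y‖) := by
          gcongr
          exact (hle y).trans (by gcongr)
      _ = C * (2 / ε) * (Real.exp (S y θ + ε * ‖S y‖) * ‖g y‖) := by
          rw [show S y θ + ε * ‖S y‖ = (S y θ + ε / 2 * ‖S y‖) + ε / 2 * ‖S y‖ by ring,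
            Real.exp_add (S y θ + ε / 2 * ‖S y‖)]
          ring

lemma ExpIntegrableNear.smulRight (hS : AEStronglyMeasurable S μ)
    (h : ExpIntegrableNear μ S g θ) :
    ExpIntegrableNear μ S (fun y => (S y).smulRight (g y)) θ :=
  h.of_norm_le hS
    ((ContinuousLinearMap.smulRightL ℝ F G).aestronglyMeasurable_comp₂ hS h.1)
    zero_le_one (fun y => by rw [ContinuousLinearMap.norm_smulRight_apply, one_mul])

lemma ExpIntegrableNear.apply_smul (hS : AEStronglyMeasurable S μ)
    (h : ExpIntegrableNear μ S g θ) (v : F) :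
    ExpIntegrableNear μ S (fun y => S y v • g y) θ :=
  h.of_norm_le hS ((hS.apply_continuousLinearMap v).smul h.1) (norm_nonneg v) (fun y => by
    rw [norm_smul, mul_comm ‖v‖]
    gcongr
    exact (S y).le_opNorm v)

lemma hasFDerivAt_expIntegral (hS : AEStronglyMeasurable S μ)
    (h : ExpIntegrableNear μ S g θ) :
    HasFDerivAt (expIntegral μ S g) (expIntegral μ S (fun y => (S y).smulRight (g y)) θ) θ := by
  have hK := h.smulRight hS
  obtain ⟨hKm, ε, hε, hi⟩ := hK
  refine _root_.hasFDerivAt_integral_of_dominated_of_fderiv_le (Metric.ball_mem_nhds θ hε)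
    (Filter.Eventually.of_forall fun θ' => aestronglyMeasurable_exp_smul hS h.1 θ')
    (h.integrable hS) (aestronglyMeasurable_exp_smul hS hKm θ)
    (F' := fun θ' y => Real.exp (S y θ') • (S y).smulRight (g y))
    (Filter.Eventually.of_forall fun y θ' hθ' => ?_) hi
    (Filter.Eventually.of_forall fun y θ' _ => ?_)
  · rw [norm_smul, Real.norm_of_nonneg (Real.exp_pos _).le]
    gcongr
    have h1 : S y θ' = S y θ + S y (θ' - θ) := by simp
    have h2 := (le_abs_self _).trans ((S y).le_opNorm (θ' - θ))
    have h3 : ‖θ' - θ‖ ≤ ε := by rw [← dist_eq_norm]; exact (Metric.mem_ball.1 hθ').le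
    rw [h1]
    nlinarith [norm_nonneg (S y)]
  · have := ((S y).hasFDerivAt (x := θ')).exp.smul_const (g y)
    convert this using 1
    ext v
    simp [smul_smul]

lemma hasFDerivAt_expIntegral_apply [CompleteSpace G] (hS : AEStronglyMeasurable S μ)
    (h : ExpIntegrableNear μ S g θ) (v : F) :
    expIntegral μ S (fun y => (S y).smulRight (g y)) θ v
      = expIntegral μ S (fun y => S y v • g y) θ := by
  unfold expIntegral
  rw [ContinuousLinearMap.integral_apply ((h.smulRight hS).integrable hS)]
  simp

lemma contDiffOn_expIntegral (hS : AEStronglyMeasurable S μ) {U : Set F} (hU : IsOpen U) (k : ℕ) :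
    ∀ {G : Type v} [NormedAddCommGroup G] [NormedSpace ℝ G] {g : Y → G},
      (∀ θ ∈ U, ExpIntegrableNear μ S g θ) → ContDiffOn ℝ k (expIntegral μ S g) U := by
  induction k with
  | zero =>
    intro G _ _ g h
    exact contDiffOn_zero.2 fun θ hθ =>
      (hasFDerivAt_expIntegral hS (h θ hθ)).continuousAt.continuousWithinAt
  | succ k ih =>
    intro G _ _ g h
    rw [Nat.cast_succ, contDiffOn_succ_iff_fderiv_of_isOpen hU]
    refine ⟨fun θ hθ =>
      (hasFDerivAt_expIntegral hS (h θ hθ)).differentiableAt.differentiableWithinAt, by simp, ?_⟩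
    exact (ih fun θ hθ => (h θ hθ).smulRight hS).congr fun θ hθ =>
      (hasFDerivAt_expIntegral hS (h θ hθ)).fderiv

end ExponentialFamily

section Gaussian

variable {n : ℕ}

/-- The parameter space `(b, c, d)` of the Gaussian weights `exp (∑ j, (c j * y j - b j * y j ^ 2) + d)`. -/
abbrev GaussParam (n : ℕ) : Type := (Fin n → ℝ) × (Fin n → ℝ) × ℝ

/-- The sufficient statistic `(b, c, d) ↦ ∑ j, (c j * y j - b j * y j ^ 2) + d`. -/
noncomputable def gaussStat (y : Fin n → ℝ) : StrongDual ℝ (GaussParam n) :=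
  ∑ j, (y j • (ContinuousLinearMap.proj (R := ℝ) (φ := fun _ : Fin n => ℝ) j ∘L
        ContinuousLinearMap.fst ℝ (Fin n → ℝ) ℝ ∘L ContinuousLinearMap.snd ℝ (Fin n → ℝ) _)
      - y j ^ 2 • (ContinuousLinearMap.proj (R := ℝ) (φ := fun _ : Fin n => ℝ) j ∘L
        ContinuousLinearMap.fst ℝ (Fin n → ℝ) _))
    + ContinuousLinearMap.snd ℝ (Fin n → ℝ) ℝ ∘L ContinuousLinearMap.snd ℝ (Fin n → ℝ) _

lemma gaussStat_apply (y : Fin n → ℝ) (θ : GaussParam n) :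
    gaussStat y θ = ∑ j, (θ.2.1 j * y j - θ.1 j * y j ^ 2) + θ.2.2 := by
  simp [gaussStat, mul_comm]

lemma continuous_gaussStat : Continuous (gaussStat (n := n)) := by
  unfold gaussStat
  fun_prop

lemma aestronglyMeasurable_gaussStat :
    AEStronglyMeasurable (gaussStat (n := n)) volume :=
  continuous_gaussStat.aestronglyMeasurable

lemma norm_gaussStat_le (y : Fin n → ℝ) : ‖gaussStat y‖ ≤ ∑ j, (1 + 2 * y j ^ 2) + 1 := by
  refine ContinuousLinearMap.opNorm_le_bound _ (by positivity) fun θ => ?_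
  have hb : ∀ j, |θ.1 j| ≤ ‖θ‖ := fun j => (norm_le_pi_norm θ.1 j).trans (norm_fst_le θ)
  have hc : ∀ j, |θ.2.1 j| ≤ ‖θ‖ := fun j =>
    (norm_le_pi_norm θ.2.1 j).trans ((norm_fst_le θ.2).trans (norm_snd_le θ))
  have hd : |θ.2.2| ≤ ‖θ‖ := (norm_snd_le θ.2).trans (norm_snd_le θ)
  rw [gaussStat_apply, Real.norm_eq_abs, add_mul, one_mul, Finset.sum_mul]
  refine (abs_add_le _ _).trans (add_le_add ((Finset.abs_sum_le_sum_abs _ _).trans ?_) hd)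
  refine Finset.sum_le_sum fun j _ => ?_
  have h1 : |y j| ≤ 1 + y j ^ 2 := by
    rw [← sq_abs (y j)]; nlinarith [sq_nonneg (|y j| - 1), abs_nonneg (y j)]
  calc |θ.2.1 j * y j - θ.1 j * y j ^ 2|
      ≤ |θ.2.1 j * y j| + |θ.1 j * y j ^ 2| := abs_sub _ _
    _ = |θ.2.1 j| * |y j| + |θ.1 j| * y j ^ 2 := by rw [abs_mul, abs_mul, abs_of_nonneg (sq_nonneg (y j))]
    _ ≤ ‖θ‖ * (1 + y j ^ 2) + ‖θ‖ * y j ^ 2 := by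
        gcongr
        exacts [hc j, hb j]
    _ = (1 + 2 * y j ^ 2) * ‖θ‖ := by ring

lemma integrable_exp_quadratic {a : ℝ} (ha : 0 < a) (c d : ℝ) :
    Integrable (fun x : ℝ => Real.exp (-a * x ^ 2 + c * x + d)) := by
  have := (integrable_cexp_quadratic (b := (a : ℂ)) (by simpa using ha) c d).norm
  refine this.congr (Filter.Eventually.of_forall fun x => ?_)
  simp only [Complex.norm_exp]
  congr 1
  simp [← Complex.ofReal_pow]

lemma expIntegrableNear_gaussStat {g : (Fin n → ℝ) → ℝ} (hg : Continuous g) {C lam : ℝ}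
    (hgrowth : ∀ x, |g x| ≤ C * Real.exp (lam * ∑ j, (x j) ^ 2)) {θ : GaussParam n}
    (hθ : ∀ j, lam < θ.1 j) : ExpIntegrableNear volume gaussStat g θ := by
  have hev : ∀ᶠ ε : ℝ in nhdsWithin 0 (Set.Ioi 0), ∀ j, 0 < θ.1 j - lam - 2 * ε := by
    refine Filter.eventually_all.2 fun j => nhdsWithin_le_nhds ?_
    refine ContinuousAt.eventually_lt (f := fun _ : ℝ => (0 : ℝ))
      (g := fun ε => θ.1 j - lam - 2 * ε) (by fun_prop) (by fun_prop) ?_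
    linarith [hθ j]
  obtain ⟨ε, hε, hε0⟩ := (hev.and self_mem_nhdsWithin).exists
  have hε0 : 0 < ε := hε0
  refine ⟨hg.aestronglyMeasurable, ε, hε0, ?_⟩
  have hprod := (Integrable.fintype_prod (μ := fun _ : Fin n => (volume : Measure ℝ))
    fun j => integrable_exp_quadratic (hε j) (θ.2.1 j) ε).const_mul (C * Real.exp (θ.2.2 + ε))
  refine Integrable.mono' hprod ?_ (Filter.Eventually.of_forall fun y => ?_)
  · have := continuous_gaussStat (n := n)
    exact Continuous.aestronglyMeasurable (by fun_prop)
  · rw [norm_mul, norm_norm, Real.norm_of_nonneg (Real.exp_pos _).le, ← Real.exp_sum]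
    calc Real.exp (gaussStat y θ + ε * ‖gaussStat y‖) * ‖g y‖
        ≤ Real.exp (gaussStat y θ + ε * (∑ j, (1 + 2 * y j ^ 2) + 1)) *
            (C * Real.exp (lam * ∑ j, (y j) ^ 2)) := by
          gcongr
          exacts [norm_gaussStat_le y, hgrowth y]
      _ = _ := by
          rw [mul_left_comm, ← Real.exp_add, mul_assoc, ← Real.exp_add, gaussStat_apply]
          congr 2
          simp only [mul_add, Finset.sum_add_distrib, Finset.sum_sub_distrib, sub_mul, neg_sub,
            ← Finset.mul_sum, mul_assoc, Finset.sum_const, nsmul_eq_mul]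
          ring

/-- The parameter of the Gaussian density with variances `a` and means `m`. -/
noncomputable def heatParam (a m : Fin n → ℝ) : GaussParam n :=
  (fun j => (2 * a j)⁻¹, fun j => m j / a j,
    ∑ j, (-(m j ^ 2 / (2 * a j)) - Real.log (2 * π * a j) / 2))

lemma exp_gaussStat_heatParam {a m : Fin n → ℝ} (ha : ∀ j, 0 < a j) (y : Fin n → ℝ) :
    Real.exp (gaussStat y (heatParam a m)) =
      ∏ j, (2 * π * a j) ^ (-(1 : ℝ) / 2) * Real.exp (-(m j - y j) ^ 2 / (2 * a j)) := by
  rw [gaussStat_apply, heatParam, ← Finset.sum_add_distrib, Real.exp_sum]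
  refine Finset.prod_congr rfl fun j _ => ?_
  have := ha j
  rw [Real.rpow_def_of_pos (by positivity), ← Real.exp_add]
  congr 1
  field_simp
  ring

/-- `g` can be integrated against every Gaussian weight `exp (∑ j, (c j * y j - b j * y j ^ 2))`
with all `b j > lam`. -/
def GaussAdmissible (lam : ℝ) (g : (Fin n → ℝ) → ℝ) : Prop :=
  ∀ θ : GaussParam n, (∀ j, lam < θ.1 j) → ExpIntegrableNear volume gaussStat g θ

/-- The function `g` times the `j`-th coordinate. -/
def coordMul (j : Fin n) (g : (Fin n → ℝ) → ℝ) (y : Fin n → ℝ) : ℝ := y j * g y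

lemma GaussAdmissible.coordMul {lam : ℝ} {g : (Fin n → ℝ) → ℝ} (h : GaussAdmissible lam g)
    (j : Fin n) : GaussAdmissible lam (coordMul j g) := fun θ hθ => by
  have := (h θ hθ).apply_smul aestronglyMeasurable_gaussStat (0, Pi.single j 1, 0)
  refine (congrArg (ExpIntegrableNear volume gaussStat · θ) (funext fun y => ?_)).mp this
  simp [gaussStat_apply, _root_.coordMul, Pi.single_apply]

/-- The convolution of `g` with the Gaussian density of variances `a`, evaluated at `m`. -/
noncomputable def heatPot (g : (Fin n → ℝ) → ℝ) (a m : Fin n → ℝ) : ℝ :=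
  expIntegral volume gaussStat g (heatParam a m)

/-- The first derivative of `heatPot g a` in the `j`-th coordinate. -/
noncomputable def heatPotDeriv (j : Fin n) (g : (Fin n → ℝ) → ℝ) (a m : Fin n → ℝ) : ℝ :=
  (heatPot (coordMul j g) a m - m j * heatPot g a m) / a j

/-- The second derivative of `heatPot g a` in the `j`-th coordinate. -/
noncomputable def heatPotDeriv₂ (j : Fin n) (g : (Fin n → ℝ) → ℝ) (a m : Fin n → ℝ) : ℝ :=
  (heatPotDeriv j (coordMul j g) a m - (heatPot g a m + m j * heatPotDeriv j g a m)) / a j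

/-- The variances and means for which `heatPot g` is defined when `g` grows at most like
`exp (lam * |y| ^ 2)`. -/
def heatDomain (n : ℕ) (lam : ℝ) : Set ((Fin n → ℝ) × (Fin n → ℝ)) :=
  {p | ∀ j, 0 < p.1 j ∧ lam < (2 * p.1 j)⁻¹}

variable {lam : ℝ} {g : (Fin n → ℝ) → ℝ}

lemma heatPot_eq_integral {a : Fin n → ℝ} (ha : ∀ j, 0 < a j) (m : Fin n → ℝ) :
    heatPot g a m = ∫ y, g y *
      ∏ j, (2 * π * a j) ^ (-(1 : ℝ) / 2) * Real.exp (-(m j - y j) ^ 2 / (2 * a j)) := by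
  unfold heatPot expIntegral
  refine integral_congr_ae (Filter.Eventually.of_forall fun y => ?_)
  simp only [exp_gaussStat_heatParam ha, smul_eq_mul]
  ring

lemma GaussAdmissible.contDiffOn_expIntegral (h : GaussAdmissible lam g) (k : ℕ) :
    ContDiffOn ℝ k (expIntegral volume gaussStat g) {θ : GaussParam n | ∀ j, lam < θ.1 j} := by
  refine _root_.contDiffOn_expIntegral aestronglyMeasurable_gaussStat ?_ k fun θ hθ => h θ hθ
  simp only [Set.ofPred_forall]
  exact isOpen_iInter_of_finite fun j => isOpen_lt continuous_const (by fun_prop)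

lemma contDiffOn_heatPot (h : GaussAdmissible lam g) (k : ℕ) :
    ContDiffOn ℝ k (fun p : (Fin n → ℝ) × (Fin n → ℝ) => heatPot g p.1 p.2)
      (heatDomain n lam) := by
  refine (h.contDiffOn_expIntegral k).comp (f := fun p : (Fin n → ℝ) × (Fin n → ℝ) =>
    heatParam p.1 p.2) ?_ fun p hp j => (hp j).2
  have ha : ∀ j, ContDiffOn ℝ k (fun p : (Fin n → ℝ) × (Fin n → ℝ) => p.1 j)
      (heatDomain n lam) := fun j => ContDiff.contDiffOn (by fun_prop)
  have hm : ∀ j, ContDiffOn ℝ k (fun p : (Fin n → ℝ) × (Fin n → ℝ) => p.2 j)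
      (heatDomain n lam) := fun j => ContDiff.contDiffOn (by fun_prop)
  have hne : ∀ j, ∀ p ∈ heatDomain n lam, p.1 j ≠ 0 := fun j p hp => (hp j).1.ne'
  have hne2 : ∀ j, ∀ p ∈ heatDomain n lam, 2 * p.1 j ≠ 0 := fun j p hp =>
    mul_ne_zero two_ne_zero (hne j p hp)
  refine ContDiffOn.prodMk (contDiffOn_pi.2 fun j => (contDiffOn_const.mul (ha j)).inv (hne2 j))
    (ContDiffOn.prodMk (contDiffOn_pi.2 fun j => (hm j).div (ha j) (hne j))
      (ContDiffOn.sum fun j _ => ?_))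
  exact (((hm j).pow 2).div (contDiffOn_const.mul (ha j)) (hne2 j)).neg.sub
    (((contDiffOn_const.mul (ha j)).log fun p hp =>
      mul_ne_zero (by positivity) (hne j p hp)).div_const 2)

lemma continuousOn_heatPot (h : GaussAdmissible lam g) :
    ContinuousOn (fun p : (Fin n → ℝ) × (Fin n → ℝ) => heatPot g p.1 p.2) (heatDomain n lam) :=
  (contDiffOn_heatPot h 0).continuousOn

lemma continuousOn_heatPotDeriv (h : GaussAdmissible lam g) (j : Fin n) :
    ContinuousOn (fun p : (Fin n → ℝ) × (Fin n → ℝ) => heatPotDeriv j g p.1 p.2)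
      (heatDomain n lam) :=
  ((continuousOn_heatPot (h.coordMul j)).sub
    ((by fun_prop : Continuous fun p : (Fin n → ℝ) × (Fin n → ℝ) => p.2 j).continuousOn.mul
      (continuousOn_heatPot h))).div
    (by fun_prop : Continuous fun p : (Fin n → ℝ) × (Fin n → ℝ) => p.1 j).continuousOn
    fun _ hp => (hp j).1.ne'

lemma continuousOn_heatPotDeriv₂ (h : GaussAdmissible lam g) (j : Fin n) :
    ContinuousOn (fun p : (Fin n → ℝ) × (Fin n → ℝ) => heatPotDeriv₂ j g p.1 p.2)
      (heatDomain n lam) :=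
  ((continuousOn_heatPotDeriv (h.coordMul j) j).sub ((continuousOn_heatPot h).add
    ((by fun_prop : Continuous fun p : (Fin n → ℝ) × (Fin n → ℝ) => p.2 j).continuousOn.mul
      (continuousOn_heatPotDeriv h j)))).div
    (by fun_prop : Continuous fun p : (Fin n → ℝ) × (Fin n → ℝ) => p.1 j).continuousOn
    fun _ hp => (hp j).1.ne'

lemma GaussAdmissible.integrable (h : GaussAdmissible lam g) {θ : GaussParam n}
    (hθ : ∀ j, lam < θ.1 j) : Integrable (fun y => Real.exp (gaussStat y θ) * g y) :=
  (h θ hθ).integrable aestronglyMeasurable_gaussStat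

lemma expIntegral_gaussStat_smul (h : GaussAdmissible lam g) {θ : GaussParam n}
    (hθ : ∀ j, lam < θ.1 j) (v : GaussParam n) :
    expIntegral volume gaussStat (fun y => gaussStat y v • g y) θ =
      ∑ j, (v.2.1 j * expIntegral volume gaussStat (coordMul j g) θ
        - v.1 j * expIntegral volume gaussStat (coordMul j (coordMul j g)) θ)
      + v.2.2 * expIntegral volume gaussStat g θ := by
  have h1 := fun j => ((h.coordMul j).integrable hθ).const_mul (v.2.1 j)
  have h2 := fun j => (((h.coordMul j).coordMul j).integrable hθ).const_mul (v.1 j)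
  have h0 := (h.integrable hθ).const_mul v.2.2
  simp only [expIntegral, smul_eq_mul, ← MeasureTheory.integral_const_mul]
  simp only [← MeasureTheory.integral_sub (h1 _) (h2 _)]
  have h3 : ∀ j, Integrable fun y => v.2.1 j * (Real.exp (gaussStat y θ) * coordMul j g y)
      - v.1 j * (Real.exp (gaussStat y θ) * coordMul j (coordMul j g) y) :=
    fun j => (h1 j).sub (h2 j)
  rw [← MeasureTheory.integral_finsetSum _ fun j _ => h3 j,
    ← MeasureTheory.integral_add (integrable_finsetSum _ fun j _ => h3 j) h0]
  refine integral_congr_ae (Filter.Eventually.of_forall fun y => ?_)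
  simp only [gaussStat_apply, coordMul]
  rw [add_mul, mul_add, Finset.sum_mul, Finset.mul_sum]
  congr 1
  · exact Finset.sum_congr rfl fun j _ => by ring
  · ring

lemma HasDerivWithinAt.heatPot (h : GaussAdmissible lam g) {a m : ℝ → Fin n → ℝ}
    {a' m' : Fin n → ℝ} {s : Set ℝ} {t : ℝ} (ht : (a t, m t) ∈ heatDomain n lam)
    (ha : ∀ j, HasDerivWithinAt (fun τ => a τ j) (a' j) s t)
    (hm : ∀ j, HasDerivWithinAt (fun τ => m τ j) (m' j) s t) :
    HasDerivWithinAt (fun τ => heatPot g (a τ) (m τ))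
      (∑ j, (a' j / 2 * heatPotDeriv₂ j g (a t) (m t) + m' j * heatPotDeriv j g (a t) (m t)))
      s t := by
  have hne : ∀ j, a t j ≠ 0 := fun j => (ht j).1.ne'
  have hne2 : ∀ j, 2 * a t j ≠ 0 := fun j => mul_ne_zero two_ne_zero (hne j)
  have hθ : HasDerivWithinAt (fun τ => heatParam (a τ) (m τ)) _ s t :=
    (hasDerivWithinAt_pi.2 fun j => ((ha j).const_mul 2).fun_inv (hne2 j)).prodMk
      ((hasDerivWithinAt_pi.2 fun j => (hm j).fun_div (ha j) (hne j)).prodMk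
        (HasDerivWithinAt.fun_sum fun j (_ : j ∈ Finset.univ) =>
          (((hm j).fun_pow 2).fun_div ((ha j).const_mul 2) (hne2 j)).fun_neg.fun_sub
            ((((ha j).const_mul (2 * π)).log (by have := hne j; positivity)).div_const 2)))
  have hdom : ∀ j, lam < (heatParam (a t) (m t)).1 j := fun j => (ht j).2
  have := (hasFDerivAt_expIntegral aestronglyMeasurable_gaussStat
    (h _ hdom)).comp_hasDerivWithinAt t hθ
  rw [hasFDerivAt_expIntegral_apply aestronglyMeasurable_gaussStat (h _ hdom),
    expIntegral_gaussStat_smul h hdom, Finset.sum_mul, ← Finset.sum_add_distrib] at this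
  refine this.congr_deriv (Finset.sum_congr rfl fun j _ => ?_)
  simp only [heatPotDeriv₂, heatPotDeriv, _root_.heatPot]
  have := hne j
  field_simp
  ring

lemma hasDerivAt_heatPot_update (h : GaussAdmissible lam g) {a m : Fin n → ℝ}
    (ha : (a, m) ∈ heatDomain n lam) (k : Fin n) (ρ : Fin n → ℝ) (ξ : ℝ) :
    HasDerivAt (fun ξ => heatPot g a (Function.update m k ξ - ρ))
      (heatPotDeriv k g a (Function.update m k ξ - ρ)) ξ := by
  rw [← hasDerivWithinAt_univ]
  have hm : ∀ j, HasDerivWithinAt (fun ξ => (Function.update m k ξ - ρ) j)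
      (Pi.single (M := fun _ => ℝ) k 1 j) Set.univ ξ := fun j =>
    hasDerivWithinAt_pi.1 (hasDerivAt_update m k ξ).hasDerivWithinAt j |>.sub_const (ρ j)
  refine (HasDerivWithinAt.heatPot h (a := fun _ => a) (a' := 0) ha
    (fun j => hasDerivWithinAt_const _ _ _) hm).congr_deriv ?_
  simp [Pi.single_apply]

lemma hasDerivAt_heatPotDeriv_update (h : GaussAdmissible lam g) {a m : Fin n → ℝ}
    (ha : (a, m) ∈ heatDomain n lam) (k : Fin n) (ρ : Fin n → ℝ) (ξ : ℝ) :
    HasDerivAt (fun ξ => heatPotDeriv k g a (Function.update m k ξ - ρ))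
      (heatPotDeriv₂ k g a (Function.update m k ξ - ρ)) ξ := by
  have hm : HasDerivAt (fun ξ => (Function.update m k ξ - ρ) k) 1 ξ := by
    simpa using (hasDerivAt_id ξ).sub_const (ρ k)
  refine (((hasDerivAt_heatPot_update (h.coordMul k) ha k ρ ξ).fun_sub
    (hm.fun_mul (hasDerivAt_heatPot_update h ha k ρ ξ))).div_const (a k)).congr_deriv ?_
  simp [heatPotDeriv₂]

end Gaussian

lemma ContinuousOn.hasDerivWithinAt_integral_left {φ : ℝ → ℝ} {a T t : ℝ}
    (hφ : ContinuousOn φ (Set.Icc a T)) (ht : t ∈ Set.Ico a T) :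
    HasDerivWithinAt (fun τ => ∫ s in τ..T, φ s) (-φ t) (Set.Ico a T) t := by
  have haT : a ≤ T := ht.1.trans ht.2.le
  have hc : Continuous (Set.IccExtend haT ((Set.Icc a T).domRestrict φ)) :=
    (continuousOn_iff_continuous_domRestrict.1 hφ).Icc_extend'
  have heq : ∀ s ∈ Set.Icc a T, Set.IccExtend haT ((Set.Icc a T).domRestrict φ) s = φ s :=
    fun s hs => Set.IccExtend_of_mem haT _ hs
  have hint : ∀ τ ∈ Set.Ico a T, ∫ s in τ..T, φ s
      = ∫ s in τ..T, Set.IccExtend haT ((Set.Icc a T).domRestrict φ) s := fun τ hτ =>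
    intervalIntegral.integral_congr fun s hs => by
      rw [Set.uIcc_of_le hτ.2.le] at hs
      exact (heq s ⟨hτ.1.trans hs.1, hs.2⟩).symm
  have := (intervalIntegral.integral_hasDerivAt_left (hc.intervalIntegrable t T)
    (hc.stronglyMeasurableAtFilter _ _) hc.continuousAt).hasDerivWithinAt (s := Set.Ico a T)
  rw [heq t ⟨ht.1, ht.2.le⟩] at this
  exact this.congr hint (hint t ht)

lemma ContinuousOn.intervalIntegrable_of_Icc_subset {φ : ℝ → ℝ} {a T s t : ℝ}
    (hφ : ContinuousOn φ (Set.Icc a T)) (hs : s ∈ Set.Icc a T) (ht : t ∈ Set.Icc a T) :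
    IntervalIntegrable φ volume s t :=
  (hφ.mono (Set.uIcc_subset_Icc hs ht)).intervalIntegrable

lemma integral_exp_integral_mul {A f : ℝ → ℝ} {a T t : ℝ} (hA : ContinuousOn A (Set.Icc a T))
    (ht : t ∈ Set.Ico a T) :
    ∫ s in t..T, Real.exp (∫ ρ in s..t, A ρ) * f s
      = Real.exp (-∫ s in t..T, A s) * ∫ s in t..T, Real.exp (∫ ρ in s..T, A ρ) * f s := by
  rw [← intervalIntegral.integral_const_mul]
  refine intervalIntegral.integral_congr fun s hs => ?_
  rw [Set.uIcc_of_le ht.2.le] at hs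
  have hs' : s ∈ Set.Icc a T := ⟨ht.1.trans hs.1, hs.2⟩
  have ht' : t ∈ Set.Icc a T := ⟨ht.1, ht.2.le⟩
  have hT' : T ∈ Set.Icc a T := ⟨ht.1.trans ht.2.le, le_rfl⟩
  have h := intervalIntegral.integral_add_adjacent_intervals
    (hA.intervalIntegrable_of_Icc_subset hs' ht') (hA.intervalIntegrable_of_Icc_subset ht' hT')
  rw [← mul_assoc, ← Real.exp_add, ← h]
  congr 2
  ring

lemma ContinuousOn.continuousOn_integral_left {φ : ℝ → ℝ} {a T : ℝ}
    (hφ : ContinuousOn φ (Set.Icc a T)) :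
    ContinuousOn (fun τ => ∫ s in τ..T, φ s) (Set.Icc a T) := by
  rcases le_or_gt a T with haT | haT
  · have := intervalIntegral.continuousOn_primitive_interval_left (μ := volume) (f := φ)
      (a := a) (b := T) (by
        rw [Set.uIcc_of_le haT]; exact hφ.integrableOn_Icc)
    rwa [Set.uIcc_of_le haT] at this
  · simp [Set.Icc_eq_empty haT.not_ge]


/-- The Feynman–Kac type function
`u(t,x) = −∫_t^T exp(∫_s^t A₁) f(s) ds + exp(−∫_t^T A₁) ∫_{ℝⁿ} g(y) ∏_j v(R_j(T)−R_j(t), x_j−∫_t^T r_j−y_j) dy`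
(with `v(t,z) = (2πt)^(−1/2) exp(−z²/(2t))`) is of class `C^{1,2}` on `[t₀,T) × ℝⁿ`
and solves the linear second-order PDE
`∂u/∂t = −(1/2) Σ_j R_j′(t) ∂²u/∂x_j² + Σ_j r_j(t) ∂u/∂x_j + A₁(t) u + f(t)`. -/
theorem feynman_kac_solves_PDE
    (n : ℕ) (hn : 1 ≤ n) (t₀ T : ℝ) (ht₀ : 0 ≤ t₀) (hT : t₀ < T)
    (R : Fin n → ℝ → ℝ)
    (hRsmooth : ∀ j, ContDiffOn ℝ 1 (R j) (Set.Icc t₀ T))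
    (hRnonneg : ∀ j, ∀ t ∈ Set.Icc t₀ T, 0 ≤ R j t)
    (hRmono : ∀ j, StrictMonoOn (R j) (Set.Icc t₀ T))
    (hRT : ∀ j, 0 < R j T)
    (r : Fin n → ℝ → ℝ) (A₁ f : ℝ → ℝ)
    (hr : ∀ j, ContinuousOn (r j) (Set.Icc t₀ T))
    (hA₁ : ContinuousOn A₁ (Set.Icc t₀ T)) (hf : ContinuousOn f (Set.Icc t₀ T))
    (Cr CA Cf : ℝ) (hrB : ∀ j, ∀ t ∈ Set.Icc t₀ T, |r j t| ≤ Cr)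
    (hA₁B : ∀ t ∈ Set.Icc t₀ T, |A₁ t| ≤ CA) (hfB : ∀ t ∈ Set.Icc t₀ T, |f t| ≤ Cf)
    (g : (Fin n → ℝ) → ℝ) (hg : Continuous g)
    (c' lam' : ℝ) (hc' : 0 < c') (hlam' : 0 < lam')
    (hlam'' : ∀ j, lam' < (16 * R j T)⁻¹)
    (hgrowth : ∀ x : Fin n → ℝ, |g x| ≤ c' * Real.exp (lam' * ∑ j, (x j) ^ 2))
    (u : ℝ → (Fin n → ℝ) → ℝ)
    (hu : ∀ t : ℝ, t₀ ≤ t → t < T → ∀ x : Fin n → ℝ,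
      u t x = -(∫ s in t..T, Real.exp (∫ ρ in s..t, A₁ ρ) * f s)
        + Real.exp (-(∫ s in t..T, A₁ s)) *
          ∫ y : Fin n → ℝ, g y *
            ∏ j, (2 * Real.pi * (R j T - R j t)) ^ (-(1 : ℝ) / 2) *
              Real.exp (-(x j - (∫ s in t..T, r j s) - y j) ^ 2
                / (2 * (R j T - R j t)))) :
    -- u is C^{1,2} on [t₀,T) × ℝⁿ:
    ((∀ t ∈ Set.Ico t₀ T, ContDiff ℝ 2 (u t)) ∧
     (∀ x : Fin n → ℝ, ∀ t ∈ Set.Ico t₀ T,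
        DifferentiableWithinAt ℝ (fun τ => u τ x) (Set.Ico t₀ T) t) ∧
     ContinuousOn
       (fun p : ℝ × (Fin n → ℝ) => derivWithin (fun τ => u τ p.2) (Set.Ico t₀ T) p.1)
       (Set.Ico t₀ T ×ˢ (Set.univ : Set (Fin n → ℝ))) ∧
     (∀ j, ContinuousOn
        (fun p : ℝ × (Fin n → ℝ) =>
          deriv (fun ξ => u p.1 (Function.update p.2 j ξ)) (p.2 j))
        (Set.Ico t₀ T ×ˢ (Set.univ : Set (Fin n → ℝ)))) ∧
     (∀ j, ContinuousOn
        (fun p : ℝ × (Fin n → ℝ) =>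
          deriv (deriv (fun ξ => u p.1 (Function.update p.2 j ξ))) (p.2 j))
        (Set.Ico t₀ T ×ˢ (Set.univ : Set (Fin n → ℝ))))) ∧
    -- the PDE:
    (∀ t ∈ Set.Ico t₀ T, ∀ x : Fin n → ℝ,
      HasDerivWithinAt (fun τ => u τ x)
        (-(1 / 2) * ∑ j, derivWithin (R j) (Set.Icc t₀ T) t *
            deriv (deriv (fun ξ => u t (Function.update x j ξ))) (x j)
          + ∑ j, r j t * deriv (fun ξ => u t (Function.update x j ξ)) (x j)
          + A₁ t * u t x + f t)
        (Set.Ico t₀ T) t) := by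
  have hIcc : ∀ {t}, t ∈ Set.Ico t₀ T → t ∈ Set.Icc t₀ T := fun h => Set.Ico_subset_Icc_self h
  have hTmem : T ∈ Set.Icc t₀ T := ⟨hT.le, le_rfl⟩
  have hadm : GaussAdmissible lam' g := fun θ hθ => expIntegrableNear_gaussStat hg hgrowth hθ
  set E : ℝ → ℝ := fun t => Real.exp (-(∫ s in t..T, A₁ s)) with hE
  set W : ℝ → ℝ := fun t => ∫ s in t..T, Real.exp (∫ ρ in s..T, A₁ ρ) * f s with hW
  set a : ℝ → Fin n → ℝ := fun t j => R j T - R j t with ha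
  set m : ℝ → Fin n → ℝ := fun t j => ∫ s in t..T, r j s with hm
  have hdom : ∀ t ∈ Set.Ico t₀ T, ∀ x : Fin n → ℝ, (a t, x) ∈ heatDomain n lam' := by
    intro t ht x j
    have h1 : 0 < R j T - R j t := sub_pos.2 (hRmono j (hIcc ht) hTmem ht.2)
    refine ⟨h1, (hlam'' j).trans_le ?_⟩
    have := hRnonneg j t (hIcc ht)
    have := hRT j
    simp only [ha]
    gcongr <;> linarith
  have huE : ∀ t ∈ Set.Ico t₀ T, ∀ x, u t x = E t * (heatPot g (a t) (x - m t) - W t) := by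
    intro t ht x
    rw [hu t ht.1 ht.2 x, integral_exp_integral_mul hA₁ ht,
      heatPot_eq_integral (fun j => (hdom t ht x j).1)]
    simp only [hE, hW, ha, hm, Pi.sub_apply]
    ring
  have hupd : ∀ t ∈ Set.Ico t₀ T, ∀ (x : Fin n → ℝ) (j : Fin n),
      deriv (fun ξ => u t (Function.update x j ξ))
        = fun ξ => E t * heatPotDeriv j g (a t) (Function.update x j ξ - m t) := by
    intro t ht x j
    funext ξ
    simp only [huE t ht]
    exact (((hasDerivAt_heatPot_update hadm (hdom t ht x) j (m t) ξ).sub_const _).const_mul _).deriv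
  have hd1 : ∀ t ∈ Set.Ico t₀ T, ∀ (x : Fin n → ℝ) (j : Fin n),
      deriv (fun ξ => u t (Function.update x j ξ)) (x j)
        = E t * heatPotDeriv j g (a t) (x - m t) := by
    intro t ht x j
    simp only [hupd t ht, Function.update_eq_self]
  have hd2 : ∀ t ∈ Set.Ico t₀ T, ∀ (x : Fin n → ℝ) (j : Fin n),
      deriv (deriv (fun ξ => u t (Function.update x j ξ))) (x j)
        = E t * heatPotDeriv₂ j g (a t) (x - m t) := by
    intro t ht x j
    rw [hupd t ht, ((hasDerivAt_heatPotDeriv_update hadm (hdom t ht x) j (m t)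
      (x j)).const_mul _).deriv, Function.update_eq_self]
  have hRd : ∀ j, ∀ t ∈ Set.Ico t₀ T,
      HasDerivWithinAt (R j) (derivWithin (R j) (Set.Icc t₀ T) t) (Set.Ico t₀ T) t := fun j t ht =>
    (((hRsmooth j).differentiableOn one_ne_zero t (hIcc ht)).hasDerivWithinAt).mono
      Set.Ico_subset_Icc_self
  have hAint := hA₁.continuousOn_integral_left
  have hpde : ∀ t ∈ Set.Ico t₀ T, ∀ x : Fin n → ℝ,
      HasDerivWithinAt (fun τ => u τ x)
        (-(1 / 2) * ∑ j, derivWithin (R j) (Set.Icc t₀ T) t *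
            deriv (deriv (fun ξ => u t (Function.update x j ξ))) (x j)
          + ∑ j, r j t * deriv (fun ξ => u t (Function.update x j ξ)) (x j)
          + A₁ t * u t x + f t)
        (Set.Ico t₀ T) t := by
    intro t ht x
    have hEd : HasDerivWithinAt E (A₁ t * E t) (Set.Ico t₀ T) t :=
      (hA₁.hasDerivWithinAt_integral_left ht).fun_neg.exp.congr_deriv (by simp only [hE]; ring)
    have hWd : HasDerivWithinAt W (-(Real.exp (∫ ρ in t..T, A₁ ρ) * f t)) (Set.Ico t₀ T) t :=
      ContinuousOn.hasDerivWithinAt_integral_left (hAint.rexp.mul hf) ht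
    have hEexp : E t * Real.exp (∫ ρ in t..T, A₁ ρ) = 1 := by
      simp only [hE, ← Real.exp_add, neg_add_cancel, Real.exp_zero]
    have hP := HasDerivWithinAt.heatPot hadm (a := a) (m := fun τ => x - m τ)
      (hdom t ht (x - m t)) (fun j => (hRd j t ht).const_sub (R j T))
      (fun j => ((hr j).hasDerivWithinAt_integral_left ht).const_sub (x j))
    refine ((hEd.fun_mul (hP.fun_sub hWd)).congr (fun τ hτ => huE τ hτ x)
      (huE t ht x)).congr_deriv ?_
    simp only [hd1 t ht, hd2 t ht]
    simp only [huE t ht, Finset.mul_sum, mul_add, mul_sub, neg_neg,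
      sub_neg_eq_add, Finset.sum_add_distrib]
    rw [← mul_assoc (E t) (Real.exp _), hEexp]
    have e1 : ∀ j, E t * (-derivWithin (R j) (Set.Icc t₀ T) t / 2 *
        heatPotDeriv₂ j g (a t) (x - m t)) = -(1 / 2) * (derivWithin (R j) (Set.Icc t₀ T) t *
        (E t * heatPotDeriv₂ j g (a t) (x - m t))) := fun j => by ring
    have e2 : ∀ j, E t * (r j t * heatPotDeriv j g (a t) (x - m t))
        = r j t * (E t * heatPotDeriv j g (a t) (x - m t)) := fun j => by ring
    simp only [e1, e2]
    ring
  set Q : Set (ℝ × (Fin n → ℝ)) := Set.Ico t₀ T ×ˢ (Set.univ : Set (Fin n → ℝ)) with hQ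
  have hlift : ∀ {φ : ℝ → ℝ}, ContinuousOn φ (Set.Icc t₀ T) →
      ContinuousOn (fun p : ℝ × (Fin n → ℝ) => φ p.1) Q := fun hφ =>
    hφ.comp continuous_fst.continuousOn fun p hp => hIcc hp.1
  have hEc : ContinuousOn (fun p : ℝ × (Fin n → ℝ) => E p.1) Q := hlift hAint.neg.rexp
  have hWc : ContinuousOn (fun p : ℝ × (Fin n → ℝ) => W p.1) Q :=
    hlift (ContinuousOn.continuousOn_integral_left (hAint.rexp.mul hf))
  have hamc : ContinuousOn (fun p : ℝ × (Fin n → ℝ) => (a p.1, p.2 - m p.1)) Q :=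
    (continuousOn_pi.2 fun j =>
      hlift (continuousOn_const.sub (hRsmooth j).continuousOn)).prodMk
    (continuousOn_snd.sub (continuousOn_pi.2 fun j => hlift (hr j).continuousOn_integral_left))
  have hmaps : Set.MapsTo (fun p : ℝ × (Fin n → ℝ) => (a p.1, p.2 - m p.1)) Q
    (heatDomain n lam') := fun p hp => hdom p.1 hp.1 _
  have huc : ContinuousOn (fun p : ℝ × (Fin n → ℝ) => u p.1 p.2) Q :=
    (hEc.mul (((continuousOn_heatPot hadm).comp hamc hmaps).sub hWc)).congr
      fun p hp => huE p.1 hp.1 p.2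
  have hd1c : ∀ j, ContinuousOn (fun p : ℝ × (Fin n → ℝ) =>
      deriv (fun ξ => u p.1 (Function.update p.2 j ξ)) (p.2 j)) Q := fun j =>
    (hEc.mul ((continuousOn_heatPotDeriv hadm j).comp hamc hmaps)).congr
      fun p hp => hd1 p.1 hp.1 p.2 j
  have hd2c : ∀ j, ContinuousOn (fun p : ℝ × (Fin n → ℝ) =>
      deriv (deriv (fun ξ => u p.1 (Function.update p.2 j ξ))) (p.2 j)) Q := fun j =>
    (hEc.mul ((continuousOn_heatPotDeriv₂ hadm j).comp hamc hmaps)).congr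
      fun p hp => hd2 p.1 hp.1 p.2 j
  refine ⟨⟨fun t ht => ?_, fun x t ht => (hpde t ht x).differentiableWithinAt, ?_, hd1c, hd2c⟩,
    hpde⟩
  · rw [funext (huE t ht)]
    refine contDiff_const.mul (ContDiff.sub ?_ contDiff_const)
    exact (contDiffOn_heatPot hadm 2).comp_contDiff (f := fun x => (a t, x - m t))
      (by fun_prop) fun x => hdom t ht _
  · refine ContinuousOn.congr ?_ fun p hp =>
      (hpde p.1 hp.1 p.2).derivWithin (uniqueDiffOn_Ico t₀ T p.1 hp.1)
    have hRc := fun j => hlift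
      ((hRsmooth j).continuousOn_derivWithin (uniqueDiffOn_Icc hT) le_rfl)
    exact (((continuousOn_const.mul (continuousOn_finsetSum _ fun j _ =>
      (hRc j).mul (hd2c j))).add (continuousOn_finsetSum _ fun j _ =>
      (hlift (hr j)).mul (hd1c j))).add ((hlift hA₁).mul huc)).add (hlift hf)
end

section
/- For every t ∈ [0,T], V(T) − V(t) = 2 ∫_0^t ∫_t^T σ_r σ_{r′} φ(r,r′) dr′ dr + ∫_0^t ( ∫_t^T σ_r (∂K/∂t)(r,s) dr )² ds + ∫_t^T ( ∫_s^T σ_r (∂K/∂t)(r,s) dr )² ds, all integrals converging absolutely. (V(t) is the variance of the Wiener integral N_t = ∫_0^t σ δX with respect to the Volterra process with kernel K.) -/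
open Real MeasureTheory intervalIntegral

section Fubini

variable {F : ℝ → ℝ → ℝ} {μ : Measure ℝ}

lemma integrable_setIntegral_mul_setIntegral [SFinite μ] (hF : Measurable (Function.uncurry F))
    (hint : ∀ s, Integrable (F s)) (hsq : Integrable (fun s => (∫ r, |F s r|) ^ 2) μ)
    (A B : Set ℝ) :
    Integrable (fun s => (∫ r in A, F s r) * ∫ r in B, F s r) μ := by
  have hmeas : ∀ A : Set ℝ, StronglyMeasurable fun s => ∫ r in A, F s r := fun A =>
    hF.stronglyMeasurable.integral_prod_right
  have hle : ∀ (A : Set ℝ) s, |∫ r in A, F s r| ≤ ∫ r, |F s r| := fun A s =>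
    MeasureTheory.abs_integral_le_integral_abs.trans
      (setIntegral_le_integral (hint s).abs (.of_forall fun _ => abs_nonneg _))
  refine hsq.mono' ((hmeas A).mul (hmeas B)).aestronglyMeasurable (.of_forall fun s => ?_)
  rw [norm_mul, sq]
  exact mul_le_mul (hle A s) (hle B s) (norm_nonneg _) ((abs_nonneg _).trans (hle A s))

lemma integrable_prod_mul_sections [SFinite μ] (hF : Measurable (Function.uncurry F))
    (hint : ∀ s, Integrable (F s)) (hsq : Integrable (fun s => (∫ r, |F s r|) ^ 2) μ)
    (A B : Set ℝ) :
    Integrable (fun p : ℝ × ℝ × ℝ => F p.1 p.2.1 * F p.1 p.2.2)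
      (μ.prod ((volume.restrict A).prod (volume.restrict B))) := by
  have h1 : Measurable fun p : ℝ × ℝ × ℝ => F p.1 p.2.1 :=
    hF.comp (measurable_fst.prodMk (measurable_fst.comp measurable_snd))
  have h2 : Measurable fun p : ℝ × ℝ × ℝ => F p.1 p.2.2 :=
    hF.comp (measurable_fst.prodMk (measurable_snd.comp measurable_snd))
  rw [integrable_prod_iff (f := fun p : ℝ × ℝ × ℝ => F p.1 p.2.1 * F p.1 p.2.2)
    (h1.mul h2).aestronglyMeasurable]
  refine ⟨.of_forall fun s => (hint s).integrableOn.mul_prod (hint s).integrableOn, ?_⟩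
  have habs : Measurable (Function.uncurry fun s r => |F s r|) := hF.norm
  have := integrable_setIntegral_mul_setIntegral (F := fun s r => |F s r|) habs
    (fun s => (hint s).abs) (by simpa using hsq) A B
  refine this.congr (.of_forall fun s => ?_)
  simp only [norm_mul, Real.norm_eq_abs]
  exact (integral_prod_mul (fun r => |F s r|) fun r => |F s r|).symm

lemma integral_setIntegral_mul_setIntegral [SFinite μ] (hF : Measurable (Function.uncurry F))
    (hint : ∀ s, Integrable (F s)) (hsq : Integrable (fun s => (∫ r, |F s r|) ^ 2) μ)
    (A B : Set ℝ) :
    ∫ s, (∫ r in A, F s r) * (∫ r in B, F s r) ∂μ =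
      ∫ r in A, ∫ r' in B, ∫ s, F s r * F s r' ∂μ := by
  have h := integrable_prod_mul_sections hF hint hsq A B
  rw [← integral_prod _ h.integral_prod_right,
    ← integral_prod_symm _ h, integral_prod _ h]
  refine integral_congr_ae (.of_forall fun s => ?_)
  exact (integral_prod_mul (F s) (F s)).symm

lemma integrable_setIntegral_integral_mul [SFinite μ] (hF : Measurable (Function.uncurry F))
    (hint : ∀ s, Integrable (F s)) (hsq : Integrable (fun s => (∫ r, |F s r|) ^ 2) μ)
    (A B : Set ℝ) :
    IntegrableOn (fun r => ∫ r' in B, ∫ s, F s r * F s r' ∂μ) A :=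
  (integrable_prod_mul_sections hF hint hsq A B).integral_prod_right.integral_prod_left

end Fubini

/-- The product `σ r * K' r s`, extended by zero outside the open simplex `0 < s < r < T`. -/
noncomputable def volterraIntegrand (T : ℝ) (K' : ℝ → ℝ → ℝ) (σ : ℝ → ℝ) (s r : ℝ) : ℝ :=
  {p : ℝ × ℝ | 0 < p.1 ∧ p.1 < p.2 ∧ p.2 < T}.indicator (fun p => σ p.2 * K' p.2 p.1) (s, r)

section VolterraIntegrand

variable {T : ℝ} {K' : ℝ → ℝ → ℝ} {σ : ℝ → ℝ}

lemma volterraIntegrand_of_mem {s r : ℝ} (h0 : 0 < s) (hsr : s < r) (hr : r < T) :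
    volterraIntegrand T K' σ s r = σ r * K' r s :=
  Set.indicator_of_mem (s := {p : ℝ × ℝ | 0 < p.1 ∧ p.1 < p.2 ∧ p.2 < T}) ⟨h0, hsr, hr⟩ _

lemma volterraIntegrand_of_notMem {s r : ℝ} (h : ¬ (0 < s ∧ s < r ∧ r < T)) :
    volterraIntegrand T K' σ s r = 0 :=
  Set.indicator_of_notMem (s := {p : ℝ × ℝ | 0 < p.1 ∧ p.1 < p.2 ∧ p.2 < T}) h _

lemma measurable_volterraIntegrand
    (hK' : ContinuousOn (fun p : ℝ × ℝ => K' p.1 p.2) {p : ℝ × ℝ | 0 < p.2 ∧ p.2 < p.1 ∧ p.1 < T})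
    (hσ : Measurable σ) : Measurable (Function.uncurry (volterraIntegrand T K' σ)) := by
  classical
  set S := {p : ℝ × ℝ | 0 < p.1 ∧ p.1 < p.2 ∧ p.2 < T}
  have hS : MeasurableSet S :=
    (measurableSet_lt measurable_const measurable_fst).inter
      ((measurableSet_lt measurable_fst measurable_snd).inter
        (measurableSet_lt measurable_snd measurable_const))
  have hc : ContinuousOn (fun p : ℝ × ℝ => K' p.2 p.1) S :=
    hK'.comp continuous_swap.continuousOn fun p hp => hp
  have hm : Measurable (S.piecewise (fun p : ℝ × ℝ => K' p.2 p.1) fun _ => 0) :=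
    hc.measurable_piecewise continuousOn_const hS
  convert (hσ.comp measurable_snd).mul hm using 1
  ext ⟨s, r⟩
  by_cases h : (s, r) ∈ S
  · rw [Pi.mul_apply, S.piecewise_eq_of_mem _ _ h]
    exact volterraIntegrand_of_mem h.1 h.2.1 h.2.2
  · rw [Pi.mul_apply, S.piecewise_eq_of_notMem _ _ h, mul_zero]
    exact volterraIntegrand_of_notMem h

lemma integral_volterraIntegrand {s x y : ℝ} (h0 : 0 < s) (hsx : s ≤ x) (hxy : x ≤ y)
    (hy : y ≤ T) :
    ∫ r in x..y, volterraIntegrand T K' σ s r = ∫ r in x..y, σ r * K' r s := by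
  refine integral_congr_ae ?_
  filter_upwards [volume.ae_ne T] with r hr hmem
  rw [Set.uIoc_of_le hxy] at hmem
  exact volterraIntegrand_of_mem h0 (hsx.trans_lt hmem.1) (lt_of_le_of_ne (hmem.2.trans hy) hr)

lemma integral_volterraIntegrand_eq_zero {s : ℝ} (h0 : 0 ≤ s) :
    ∫ r in (0 : ℝ)..s, volterraIntegrand T K' σ s r = 0 := by
  refine integral_zero_ae (.of_forall fun r hr => volterraIntegrand_of_notMem fun h => ?_)
  rw [Set.uIoc_of_le h0] at hr
  exact h.2.1.not_ge hr.2

lemma integral_volterraIntegrand_mul {t r r' : ℝ} (h0 : 0 < r) (hrt : r < t) (htr : t < r')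
    (hr : r' < T) :
    ∫ s in Set.Ioc 0 t, volterraIntegrand T K' σ s r * volterraIntegrand T K' σ s r' =
      σ r * σ r' * ∫ u in (0 : ℝ)..(min r r'), K' r u * K' r' u := by
  rw [min_eq_left (hrt.trans htr).le, ← intervalIntegral.integral_const_mul,
    intervalIntegral.integral_of_le h0.le, integral_Ioc_eq_integral_Ioo (y := r)]
  rw [setIntegral_eq_of_subset_of_forall_sdiff_eq_zero measurableSet_Ioc
    (Set.Ioo_subset_Ioc_self.trans (Set.Ioc_subset_Ioc_right hrt.le))]
  · refine setIntegral_congr_fun measurableSet_Ioo fun s hs => ?_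
    simp only [volterraIntegrand_of_mem hs.1 hs.2 ((hrt.trans htr).trans hr),
      volterraIntegrand_of_mem hs.1 (hs.2.trans (hrt.trans htr)) hr]
    ring
  · intro s hs
    rw [volterraIntegrand_of_notMem (r := r) fun h => hs.2 ⟨h.1, h.2.1⟩, zero_mul]

variable {α β c C : ℝ}

lemma abs_volterraIntegrand_le (hβ : 0 ≤ β) (hc : 0 ≤ c)
    (hK' : ∀ s t : ℝ, 0 < s → s < t → t < T → |K' t s| ≤ c * (t - s) ^ (α - 1) * (t / s) ^ β)
    (hσ : ∀ t ∈ Set.Icc (0 : ℝ) T, |σ t| ≤ C) {s r : ℝ} (h0 : 0 < s) (hsr : s < r) (hr : r < T) :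
    |volterraIntegrand T K' σ s r| ≤ C * c * T ^ β * s ^ (-β) * (r - s) ^ (α - 1) := by
  have hr0 : 0 < r := h0.trans hsr
  have hσr := hσ r ⟨hr0.le, hr.le⟩
  have hC : 0 ≤ C := (abs_nonneg _).trans hσr
  have hsub : 0 < r - s := sub_pos.2 hsr
  rw [volterraIntegrand_of_mem h0 hsr hr, abs_mul]
  calc |σ r| * |K' r s| ≤ C * (c * (r - s) ^ (α - 1) * (T / s) ^ β) := by
        refine mul_le_mul hσr ((hK' s r h0 hsr hr).trans ?_) (abs_nonneg _) hC
        gcongr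
    _ = C * c * T ^ β * s ^ (-β) * (r - s) ^ (α - 1) := by
        rw [Real.div_rpow (hr0.trans hr).le h0.le, Real.rpow_neg h0.le]
        ring

lemma integrableOn_sub_left_rpow (s T : ℝ) (hα : 0 < α) :
    IntegrableOn (fun r => (r - s) ^ (α - 1)) (Set.Ioo s T) := by
  rcases le_or_gt T s with h | h
  · simp [Set.Ioo_eq_empty h.not_gt]
  have h1 : IntervalIntegrable (fun x : ℝ => x ^ (α - 1)) volume 0 (T - s) :=
    intervalIntegrable_rpow' (by linarith)
  have h2 := h1.comp_sub_right s
  rw [zero_add, sub_add_cancel, intervalIntegrable_iff_integrableOn_Ioo_of_le h.le] at h2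
  exact h2

lemma integral_sub_left_rpow {s : ℝ} (h : s ≤ T) (hα : 0 < α) :
    ∫ r in Set.Ioo s T, (r - s) ^ (α - 1) = (T - s) ^ α / α := by
  rw [← integral_Ioc_eq_integral_Ioo, ← intervalIntegral.integral_of_le h,
    intervalIntegral.integral_comp_sub_right (fun x => x ^ (α - 1)) s,
    integral_rpow (.inl (by linarith))]
  simp [hα.ne']

lemma volterraIntegrand_eq_indicator (s : ℝ) :
    volterraIntegrand T K' σ s = (Set.Ioo s T).indicator (volterraIntegrand T K' σ s) := by
  refine (Set.indicator_eq_self.2 fun r hr => ?_).symm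
  by_contra h
  exact hr (volterraIntegrand_of_notMem fun h' => h h'.2)

lemma integrable_volterraIntegrand (hα : 0 < α) (hβ : 0 ≤ β) (hc : 0 ≤ c)
    (hm : Measurable (Function.uncurry (volterraIntegrand T K' σ)))
    (hK' : ∀ s t : ℝ, 0 < s → s < t → t < T → |K' t s| ≤ c * (t - s) ^ (α - 1) * (t / s) ^ β)
    (hσ : ∀ t ∈ Set.Icc (0 : ℝ) T, |σ t| ≤ C) (s : ℝ) :
    Integrable (volterraIntegrand T K' σ s) := by
  rcases le_or_gt s 0 with h0 | h0
  · have : volterraIntegrand T K' σ s = fun _ => 0 :=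
      funext fun r => volterraIntegrand_of_notMem fun h => h.1.not_ge h0
    rw [this]
    exact integrable_zero _ _ _
  rw [volterraIntegrand_eq_indicator, integrable_indicator_iff measurableSet_Ioo]
  refine ((integrableOn_sub_left_rpow s T hα).const_mul (C * c * T ^ β * s ^ (-β))).mono'
    (hm.comp measurable_prodMk_left).aestronglyMeasurable ?_
  filter_upwards [ae_restrict_mem measurableSet_Ioo] with r hr
  exact abs_volterraIntegrand_le hβ hc hK' hσ h0 hr.1 hr.2

lemma integral_abs_volterraIntegrand_le (hα : 0 < α) (hβ : 0 ≤ β) (hc : 0 ≤ c)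
    (hm : Measurable (Function.uncurry (volterraIntegrand T K' σ)))
    (hK' : ∀ s t : ℝ, 0 < s → s < t → t < T → |K' t s| ≤ c * (t - s) ^ (α - 1) * (t / s) ^ β)
    (hσ : ∀ t ∈ Set.Icc (0 : ℝ) T, |σ t| ≤ C) {s : ℝ} (h0 : 0 < s) (hs : s ≤ T) :
    ∫ r, |volterraIntegrand T K' σ s r| ≤ C * c * T ^ β * (T ^ α / α) * s ^ (-β) := by
  have hC : 0 ≤ C := (abs_nonneg _).trans (hσ s ⟨h0.le, hs⟩)
  have hT : 0 < T := h0.trans_le hs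
  have hsupp : ∫ r, |volterraIntegrand T K' σ s r| =
      ∫ r in Set.Ioo s T, |volterraIntegrand T K' σ s r| := by
    refine (setIntegral_eq_integral_of_forall_compl_eq_zero fun r hr => ?_).symm
    rw [volterraIntegrand_of_notMem fun h => hr h.2, abs_zero]
  calc ∫ r, |volterraIntegrand T K' σ s r|
      ≤ ∫ r in Set.Ioo s T, C * c * T ^ β * s ^ (-β) * (r - s) ^ (α - 1) := by
        rw [hsupp]
        exact setIntegral_mono_on
          (integrable_volterraIntegrand hα hβ hc hm hK' hσ s).abs.integrableOn
          ((integrableOn_sub_left_rpow s T hα).const_mul _) measurableSet_Ioo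
          fun r hr => abs_volterraIntegrand_le hβ hc hK' hσ h0 hr.1 hr.2
    _ = C * c * T ^ β * s ^ (-β) * ((T - s) ^ α / α) := by
        rw [MeasureTheory.integral_const_mul, integral_sub_left_rpow hs hα]
    _ ≤ C * c * T ^ β * s ^ (-β) * (T ^ α / α) := by
        have : 0 ≤ T - s := sub_nonneg.2 hs
        have : T - s ≤ T := by linarith
        gcongr
    _ = _ := by ring

lemma integrableOn_sq_integral_abs_volterraIntegrand (hα : 0 < α) (hβ : 0 ≤ β) (hβ' : β < 1 / 2)
    (hc : 0 ≤ c) (hm : Measurable (Function.uncurry (volterraIntegrand T K' σ)))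
    (hK' : ∀ s t : ℝ, 0 < s → s < t → t < T → |K' t s| ≤ c * (t - s) ^ (α - 1) * (t / s) ^ β)
    (hσ : ∀ t ∈ Set.Icc (0 : ℝ) T, |σ t| ≤ C) :
    IntegrableOn (fun s => (∫ r, |volterraIntegrand T K' σ s r|) ^ 2) (Set.Ioc 0 T) := by
  rcases lt_or_ge T 0 with hT | hT
  · simp [Set.Ioc_eq_empty hT.le.not_gt]
  have hpow : IntegrableOn (fun s : ℝ => s ^ (-(2 * β))) (Set.Ioc 0 T) :=
    (intervalIntegrable_iff_integrableOn_Ioc_of_le hT).1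
      (intervalIntegrable_rpow' (by linarith))
  have habs : Measurable (Function.uncurry fun s r => |volterraIntegrand T K' σ s r|) := hm.norm
  refine (hpow.const_mul ((C * c * T ^ β * (T ^ α / α)) ^ 2)).mono'
    (habs.stronglyMeasurable.integral_prod_right.pow 2).aestronglyMeasurable ?_
  filter_upwards [ae_restrict_mem measurableSet_Ioc] with s hs
  have hle := integral_abs_volterraIntegrand_le hα hβ hc hm hK' hσ hs.1 hs.2
  have hnn : 0 ≤ ∫ r, |volterraIntegrand T K' σ s r| := integral_nonneg fun _ => abs_nonneg _
  rw [norm_pow, Real.norm_eq_abs, abs_of_nonneg hnn]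
  refine (pow_le_pow_left₀ hnn hle 2).trans_eq ?_
  rw [mul_pow, ← Real.rpow_natCast (s ^ (-β)) 2, ← Real.rpow_mul hs.1.le]
  congr 2
  push_cast
  ring

lemma integrableOn_rpow_mul_sub_right_rpow {γ : ℝ} (hα : 0 < α) (hα' : α ≤ 1) (hγ : 0 ≤ γ)
    (hγ' : γ < 1) {r : ℝ} (hr : 0 < r) :
    IntegrableOn (fun s => s ^ (-γ) * (r - s) ^ (α - 1)) (Set.Ioo 0 r) := by
  have h1 : IntegrableOn (fun s : ℝ => s ^ (-γ)) (Set.Ioo 0 r) :=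
    (intervalIntegrable_iff_integrableOn_Ioo_of_le hr.le).1
      (intervalIntegrable_rpow' (by linarith))
  have h2 : IntegrableOn (fun s : ℝ => (r - s) ^ (α - 1)) (Set.Ioo 0 r) := by
    have h : IntervalIntegrable (fun x : ℝ => x ^ (α - 1)) volume 0 r :=
      intervalIntegrable_rpow' (by linarith)
    have h' := (h.comp_sub_left r).symm
    rw [sub_zero, sub_self, intervalIntegrable_iff_integrableOn_Ioo_of_le hr.le] at h'
    exact h'
  have hmeas : Measurable fun s : ℝ => s ^ (-γ) * (r - s) ^ (α - 1) := by fun_prop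
  refine ((h1.const_mul ((r / 2) ^ (α - 1))).add (h2.const_mul ((r / 2) ^ (-γ)))).mono'
    hmeas.aestronglyMeasurable ?_
  filter_upwards [ae_restrict_mem measurableSet_Ioo] with s ⟨hs0, hsr⟩
  have hsub : 0 < r - s := sub_pos.2 hsr
  have e1 : 0 ≤ s ^ (-γ) := by positivity
  have e2 : 0 ≤ (r - s) ^ (α - 1) := by positivity
  have e3 : 0 ≤ (r / 2) ^ (-γ) := by positivity
  have e4 : 0 ≤ (r / 2) ^ (α - 1) := by positivity
  rw [Real.norm_of_nonneg (mul_nonneg e1 e2), Pi.add_apply]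
  rcases le_total s (r / 2) with h | h
  · have := Real.rpow_le_rpow_of_nonpos (half_pos hr) (by linarith : r / 2 ≤ r - s)
      (by linarith : α - 1 ≤ 0)
    nlinarith [mul_le_mul_of_nonneg_left this e1, mul_nonneg e3 e2]
  · have := Real.rpow_le_rpow_of_nonpos (half_pos hr) h (by linarith : -γ ≤ 0)
    nlinarith [mul_le_mul_of_nonneg_right this e2, mul_nonneg e4 e1]

lemma integrableOn_setIntegral_volterraIntegrand_mul (hα : 0 < α) (hα' : α ≤ 1) (hβ : 0 ≤ β)
    (hβ' : β < 1 / 2) (hc : 0 ≤ c)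
    (hm : Measurable (Function.uncurry (volterraIntegrand T K' σ)))
    (hK' : ∀ s t : ℝ, 0 < s → s < t → t < T → |K' t s| ≤ c * (t - s) ^ (α - 1) * (t / s) ^ β)
    (hσ : ∀ t ∈ Set.Icc (0 : ℝ) T, |σ t| ≤ C) {r t : ℝ} (hr : 0 < r) (hrt : r < t) :
    IntegrableOn (fun r' => ∫ s in Set.Ioc 0 t,
      volterraIntegrand T K' σ s r * volterraIntegrand T K' σ s r') (Set.Ioo t T) := by
  have hsupp : ∀ r', ∫ s in Set.Ioc 0 t,
      volterraIntegrand T K' σ s r * volterraIntegrand T K' σ s r' =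
      ∫ s in Set.Ioo 0 r,
        volterraIntegrand T K' σ s r * volterraIntegrand T K' σ s r' := fun r' =>
    setIntegral_eq_of_subset_of_forall_sdiff_eq_zero measurableSet_Ioc
      (Set.Ioo_subset_Ioc_self.trans (Set.Ioc_subset_Ioc_right hrt.le)) fun s hs => by
        rw [volterraIntegrand_of_notMem (r := r) fun h => hs.2 ⟨h.1, h.2.1⟩, zero_mul]
  simp only [hsupp]
  have hdom := ((integrableOn_rpow_mul_sub_right_rpow (γ := 2 * β) hα hα' (by linarith)
    (by linarith) hr).const_mul ((C * c * T ^ β) ^ 2 * (t - r) ^ (α - 1))).comp_snd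
      (volume.restrict (Set.Ioo t T))
  have h1 : Measurable fun p : ℝ × ℝ => volterraIntegrand T K' σ p.2 r :=
    hm.comp (measurable_snd.prodMk measurable_const)
  have h2 : Measurable fun p : ℝ × ℝ => volterraIntegrand T K' σ p.2 p.1 :=
    hm.comp measurable_swap
  have hint : Integrable (fun p : ℝ × ℝ =>
      volterraIntegrand T K' σ p.2 r * volterraIntegrand T K' σ p.2 p.1)
      ((volume.restrict (Set.Ioo t T)).prod (volume.restrict (Set.Ioo 0 r))) := by
    refine hdom.mono' (h1.mul h2).aestronglyMeasurable ?_
    rw [Measure.prod_restrict]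
    filter_upwards [ae_restrict_mem (measurableSet_Ioo.prod measurableSet_Ioo)] with ⟨r', s⟩
      ⟨⟨htr, hrT⟩, ⟨hs0, hsr⟩⟩
    dsimp only at htr hrT hs0 hsr ⊢
    have hT : 0 < T := by linarith
    have hC : 0 ≤ C := (abs_nonneg _).trans (hσ T ⟨hT.le, le_rfl⟩)
    have hsub : 0 < r - s := sub_pos.2 hsr
    have htr0 : 0 < t - r := sub_pos.2 hrt
    have b1 := abs_volterraIntegrand_le hβ hc hK' hσ hs0 hsr (by linarith : r < T)
    have b2 := abs_volterraIntegrand_le hβ hc hK' hσ hs0 (by linarith : s < r') hrT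
    have b3 := Real.rpow_le_rpow_of_nonpos htr0 (by linarith : t - r ≤ r' - s)
      (by linarith : α - 1 ≤ 0)
    have hM : 0 ≤ C * c * T ^ β * s ^ (-β) := by positivity
    rw [norm_mul]
    refine (mul_le_mul b1 (b2.trans (mul_le_mul_of_nonneg_left b3 hM)) (abs_nonneg _)
      (by positivity)).trans_eq ?_
    have hpow : s ^ (-(2 * β)) = s ^ (-β) * s ^ (-β) := by
      rw [← Real.rpow_add hs0]
      ring_nf
    rw [hpow]
    ring
  exact hint.integral_prod_left

end VolterraIntegrand

/-- For the variance `V(t) = ∫_0^t (∫_s^t σ_r K'(r,s) dr)² ds` of the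
Wiener integral `N_t = ∫_0^t σ δX` with respect to the Volterra process with kernel `K`
(where `K' = ∂K/∂t`), for every `t ∈ [0,T]`,
`V(T) − V(t) = 2 ∫_0^t ∫_t^T σ_r σ_{r'} φ(r,r') dr' dr
  + ∫_0^t (∫_t^T σ_r K'(r,s) dr)² ds + ∫_t^T (∫_s^T σ_r K'(r,s) dr)² ds`,
all integrals converging absolutely, with `φ(r,s) = ∫_0^{min(r,s)} K'(r,u) K'(s,u) du`. -/
theorem volterra_variance_increment_decomposition
    (T : ℝ) (hT : 0 < T) (K K' : ℝ → ℝ → ℝ)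
    (hVol : ∀ t s : ℝ, t < s → K t s = 0)
    (hKcont : ContinuousOn (fun p : ℝ × ℝ => K p.1 p.2)
      {p : ℝ × ℝ | 0 < p.2 ∧ p.2 ≤ p.1 ∧ p.1 < T})
    (hK' : ∀ s t : ℝ, 0 < s → s < t → t < T → HasDerivAt (fun τ => K τ s) (K' t s) t)
    (hK'cont : ContinuousOn (fun p : ℝ × ℝ => K' p.1 p.2)
      {p : ℝ × ℝ | 0 < p.2 ∧ p.2 < p.1 ∧ p.1 < T})
    (α β c : ℝ) (hα : 0 < α) (hα' : α < 1 / 2) (hβ : 0 < β) (hβ' : β < 1 / 2)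
    (hc : 0 < c)
    (hH2 : ∀ s t : ℝ, 0 < s → s < t → t < T →
      |K' t s| ≤ c * (t - s) ^ (α - 1) * (t / s) ^ β)
    (σ : ℝ → ℝ) (hσmeas : Measurable σ)
    (Cσ : ℝ) (hσB : ∀ t ∈ Set.Icc (0 : ℝ) T, |σ t| ≤ Cσ) :
    ∀ t ∈ Set.Icc (0 : ℝ) T,
      (∀ r ∈ Set.Ioo (0 : ℝ) t,
          IntervalIntegrable
            (fun r' => σ r * σ r' * ∫ u in (0 : ℝ)..(min r r'), K' r u * K' r' u)
            MeasureTheory.volume t T) ∧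
      IntervalIntegrable
        (fun r => ∫ r' in t..T, σ r * σ r' * ∫ u in (0 : ℝ)..(min r r'), K' r u * K' r' u)
        MeasureTheory.volume 0 t ∧
      IntervalIntegrable (fun s => (∫ r in t..T, σ r * K' r s) ^ 2)
        MeasureTheory.volume 0 t ∧
      IntervalIntegrable (fun s => (∫ r in s..T, σ r * K' r s) ^ 2)
        MeasureTheory.volume t T ∧
      (∫ s in (0 : ℝ)..T, (∫ r in s..T, σ r * K' r s) ^ 2)
          - (∫ s in (0 : ℝ)..t, (∫ r in s..t, σ r * K' r s) ^ 2)
        = 2 * (∫ r in (0 : ℝ)..t, ∫ r' in t..T,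
              σ r * σ r' * ∫ u in (0 : ℝ)..(min r r'), K' r u * K' r' u)
          + (∫ s in (0 : ℝ)..t, (∫ r in t..T, σ r * K' r s) ^ 2)
          + (∫ s in t..T, (∫ r in s..T, σ r * K' r s) ^ 2) := by
  intro t ⟨ht0, htT⟩
  set F := volterraIntegrand T K' σ
  have hm : Measurable (Function.uncurry F) := measurable_volterraIntegrand hK'cont hσmeas
  have hint : ∀ s, Integrable (F s) :=
    integrable_volterraIntegrand hα hβ.le hc.le hm hH2 hσB
  have hsqT : IntegrableOn (fun s => (∫ r, |F s r|) ^ 2) (Set.Ioc 0 T) :=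
    integrableOn_sq_integral_abs_volterraIntegrand hα hβ.le hβ' hc.le hm hH2 hσB
  have hsqt := hsqT.mono_set (Set.Ioc_subset_Ioc_right htT)
  have hφ : ∀ r ∈ Set.Ioo 0 t, ∀ r' ∈ Set.Ioo t T,
      ∫ s in Set.Ioc 0 t, F s r * F s r' =
        σ r * σ r' * ∫ u in (0 : ℝ)..(min r r'), K' r u * K' r' u := fun r hr r' hr' =>
    integral_volterraIntegrand_mul hr.1 hr.2 hr'.1 hr'.2
  have hφ' : ∀ r ∈ Set.Ioo 0 t, ∫ r' in Set.Ioc t T, ∫ s in Set.Ioc 0 t, F s r * F s r' =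
      ∫ r' in t..T, σ r * σ r' * ∫ u in (0 : ℝ)..(min r r'), K' r u * K' r' u := by
    intro r hr
    rw [intervalIntegral.integral_of_le htT, integral_Ioc_eq_integral_Ioo,
      integral_Ioc_eq_integral_Ioo]
    exact setIntegral_congr_fun measurableSet_Ioo (hφ r hr)
  have hfull : ∀ s ∈ Set.Ioc 0 T, ∀ y, s ≤ y → y ≤ T →
      ∫ r in s..y, σ r * K' r s = ∫ r in Set.Ioc 0 y, F s r := by
    intro s hs y hsy hy
    rw [← integral_volterraIntegrand hs.1 le_rfl hsy hy,
      ← intervalIntegral.integral_of_le (hs.1.le.trans hsy),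
      ← integral_add_adjacent_intervals (a := 0) (b := s) (c := y)
        (hint s).intervalIntegrable (hint s).intervalIntegrable,
      integral_volterraIntegrand_eq_zero hs.1.le, zero_add]
  have htail : ∀ s ∈ Set.Ioc 0 t, ∫ r in t..T, σ r * K' r s = ∫ r in Set.Ioc t T, F s r := by
    intro s hs
    rw [← integral_volterraIntegrand hs.1 hs.2 htT le_rfl, intervalIntegral.integral_of_le htT]
  have hsplit : ∀ s, ∫ r in Set.Ioc 0 T, F s r =
      (∫ r in Set.Ioc 0 t, F s r) + ∫ r in Set.Ioc t T, F s r := by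
    intro s
    rw [← setIntegral_union (Set.Ioc_disjoint_Ioc_of_le le_rfl) measurableSet_Ioc
      (hint s).integrableOn (hint s).integrableOn, Set.Ioc_union_Ioc_eq_Ioc ht0 htT]
  have hTT := integrable_setIntegral_mul_setIntegral hm hint hsqT (Set.Ioc 0 T) (Set.Ioc 0 T)
  have haa := integrable_setIntegral_mul_setIntegral hm hint hsqt (Set.Ioc 0 t) (Set.Ioc 0 t)
  have hab := integrable_setIntegral_mul_setIntegral hm hint hsqt (Set.Ioc 0 t) (Set.Ioc t T)
  have hbb := integrable_setIntegral_mul_setIntegral hm hint hsqt (Set.Ioc t T) (Set.Ioc t T)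
  have hsubset : Set.Ioc t T ⊆ Set.Ioc 0 T := Set.Ioc_subset_Ioc_left ht0
  have hsubset' : Set.Ioc 0 t ⊆ Set.Ioc 0 T := Set.Ioc_subset_Ioc_right htT
  refine ⟨fun r hr => ?_, ?_, ?_, ?_, ?_⟩
  · rw [intervalIntegrable_iff_integrableOn_Ioo_of_le htT]
    exact (integrableOn_setIntegral_volterraIntegrand_mul hα (by linarith) hβ.le hβ' hc.le hm hH2
      hσB hr.1 hr.2).congr_fun (hφ r hr) measurableSet_Ioo
  · rw [intervalIntegrable_iff_integrableOn_Ioo_of_le ht0]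
    exact (integrable_setIntegral_integral_mul hm hint hsqt (Set.Ioo 0 t) (Set.Ioc t T)).congr_fun
      hφ' measurableSet_Ioo
  · rw [intervalIntegrable_iff_integrableOn_Ioc_of_le ht0]
    refine IntegrableOn.congr_fun hbb (fun s hs => ?_) measurableSet_Ioc
    simp only [htail s hs, sq]
  · rw [intervalIntegrable_iff_integrableOn_Ioc_of_le htT]
    refine (IntegrableOn.mono_set hTT hsubset).congr_fun (fun s hs => ?_) measurableSet_Ioc
    simp only [hfull s (hsubset hs) T hs.2 le_rfl, sq]
  · have e1 : ∫ s in (0 : ℝ)..T, (∫ r in s..T, σ r * K' r s) ^ 2 =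
        (∫ s in Set.Ioc 0 t, (∫ r in Set.Ioc 0 T, F s r) * ∫ r in Set.Ioc 0 T, F s r) +
          ∫ s in Set.Ioc t T, (∫ r in Set.Ioc 0 T, F s r) * ∫ r in Set.Ioc 0 T, F s r := by
      rw [← setIntegral_union (Set.Ioc_disjoint_Ioc_of_le le_rfl) measurableSet_Ioc
        (IntegrableOn.mono_set hTT hsubset') (IntegrableOn.mono_set hTT hsubset),
        Set.Ioc_union_Ioc_eq_Ioc ht0 htT, intervalIntegral.integral_of_le hT.le]
      refine setIntegral_congr_fun measurableSet_Ioc fun s hs => ?_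
      simp only [hfull s hs T hs.2 le_rfl, sq]
    have e2 : ∫ s in (0 : ℝ)..t, (∫ r in s..t, σ r * K' r s) ^ 2 =
        ∫ s in Set.Ioc 0 t, (∫ r in Set.Ioc 0 t, F s r) * ∫ r in Set.Ioc 0 t, F s r := by
      rw [intervalIntegral.integral_of_le ht0]
      refine setIntegral_congr_fun measurableSet_Ioc fun s hs => ?_
      simp only [hfull s (hsubset' hs) t hs.2 htT, sq]
    have e3 : ∫ s in (0 : ℝ)..t, (∫ r in t..T, σ r * K' r s) ^ 2 =
        ∫ s in Set.Ioc 0 t, (∫ r in Set.Ioc t T, F s r) * ∫ r in Set.Ioc t T, F s r := by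
      rw [intervalIntegral.integral_of_le ht0]
      refine setIntegral_congr_fun measurableSet_Ioc fun s hs => ?_
      simp only [htail s hs, sq]
    have e4 : ∫ s in t..T, (∫ r in s..T, σ r * K' r s) ^ 2 =
        ∫ s in Set.Ioc t T, (∫ r in Set.Ioc 0 T, F s r) * ∫ r in Set.Ioc 0 T, F s r := by
      rw [intervalIntegral.integral_of_le htT]
      refine setIntegral_congr_fun measurableSet_Ioc fun s hs => ?_
      simp only [hfull s (hsubset hs) T hs.2 le_rfl, sq]
    have e5 : ∫ r in (0 : ℝ)..t, ∫ r' in t..T,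
          σ r * σ r' * ∫ u in (0 : ℝ)..(min r r'), K' r u * K' r' u =
        ∫ s in Set.Ioc 0 t, (∫ r in Set.Ioc 0 t, F s r) * ∫ r in Set.Ioc t T, F s r := by
      rw [integral_setIntegral_mul_setIntegral hm hint hsqt,
        intervalIntegral.integral_of_le ht0, integral_Ioc_eq_integral_Ioo,
        integral_Ioc_eq_integral_Ioo (x := 0)]
      exact (setIntegral_congr_fun measurableSet_Ioo hφ').symm
    have e6 : ∫ s in Set.Ioc 0 t, (∫ r in Set.Ioc 0 T, F s r) * ∫ r in Set.Ioc 0 T, F s r =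
        (∫ s in Set.Ioc 0 t, (∫ r in Set.Ioc 0 t, F s r) * ∫ r in Set.Ioc 0 t, F s r) +
        2 * (∫ s in Set.Ioc 0 t, (∫ r in Set.Ioc 0 t, F s r) * ∫ r in Set.Ioc t T, F s r) +
        ∫ s in Set.Ioc 0 t, (∫ r in Set.Ioc t T, F s r) * ∫ r in Set.Ioc t T, F s r := by
      rw [← MeasureTheory.integral_const_mul, ← MeasureTheory.integral_add haa (hab.const_mul 2),
        ← MeasureTheory.integral_add (f := fun s => (∫ r in Set.Ioc 0 t, F s r) *
          (∫ r in Set.Ioc 0 t, F s r) + 2 * ((∫ r in Set.Ioc 0 t, F s r) *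
          ∫ r in Set.Ioc t T, F s r)) (haa.add (hab.const_mul 2)) hbb]
      refine integral_congr_ae (.of_forall fun s => ?_)
      simp only [hsplit s]
      ring
    rw [e1, e2, e3, e4, e5, e6]
    ring
end

section
/- If moreover σ is continuous on [0,T], then V is differentiable on (0,T) and V′(t) = 2 σ_t ∫_0^t σ_u φ(t,u) du for every t ∈ (0,T). -/
open Real MeasureTheory intervalIntegral

open Set Filter Topology

/-- The open triangle `{(r, s) : 0 < s < r < T}`. -/
def openTriangle (T : ℝ) : Set (ℝ × ℝ) := {p | 0 < p.2 ∧ p.2 < p.1 ∧ p.1 < T}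

lemma isOpen_openTriangle (T : ℝ) : IsOpen (openTriangle T) :=
  (isOpen_lt continuous_const continuous_snd).inter
    ((isOpen_lt continuous_snd continuous_fst).inter (isOpen_lt continuous_fst continuous_const))

lemma openTriangle_mono {t T : ℝ} (h : t ≤ T) : openTriangle t ⊆ openTriangle T :=
  fun _ hp => ⟨hp.1, hp.2.1, hp.2.2.trans_le h⟩

/-- Restrict a pointwise statement on the interval of integration to the open interval. -/
lemma ae_uIoc_of_forall_Ioo {a b : ℝ} (hab : a ≤ b) {p : ℝ → Prop} (h : ∀ x ∈ Ioo a b, p x) :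
    ∀ᵐ x : ℝ, x ∈ uIoc a b → p x := by
  filter_upwards [compl_mem_ae_iff.mpr (measure_singleton b)] with x hx hx'
  rw [uIoc_of_le hab] at hx'
  exact h x ⟨hx'.1, lt_of_le_of_ne hx'.2 hx⟩

lemma intervalIntegral_eq_Ioo {a b : ℝ} (hab : a ≤ b) (f : ℝ → ℝ) :
    ∫ x in a..b, f x = ∫ x in Ioo a b, f x := by
  rw [integral_of_le hab, integral_Ioc_eq_integral_Ioo]

lemma intervalIntegrable_sub_rpow {a : ℝ} (ha : 0 < a) (s t : ℝ) :
    IntervalIntegrable (fun r => (r - s) ^ (a - 1)) volume s t := by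
  have h := (intervalIntegrable_rpow' (a := 0) (b := t - s) (r := a - 1)
    (by linarith)).comp_sub_right s
  simpa using h

lemma integral_sub_rpow {a : ℝ} (ha : 0 < a) (s t : ℝ) :
    ∫ r in s..t, (r - s) ^ (a - 1) = (t - s) ^ a / a := by
  rw [intervalIntegral.integral_comp_sub_right (fun x => x ^ (a - 1)) s,
    integral_rpow (Or.inl (by linarith))]
  simp [Real.zero_rpow ha.ne']

lemma intervalIntegrable_beta {a b : ℝ} (ha : 0 < a) (hb : b < 1) {t : ℝ} (ht : 0 < t) :
    IntervalIntegrable (fun x => (t - x) ^ (a - 1) * x ^ (-b)) volume 0 t := by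
  refine IntervalIntegrable.trans (b := t / 2) ?_ ?_
  · refine IntervalIntegrable.continuousOn_mul (intervalIntegrable_rpow' (by linarith)) ?_
    refine ContinuousOn.rpow_const (by fun_prop) fun x hx => Or.inl ?_
    rw [uIcc_of_le (by linarith)] at hx
    linarith [hx.2]
  · refine IntervalIntegrable.mul_continuousOn ?_ ?_
    · have h := (intervalIntegrable_rpow' (a := t / 2) (b := 0) (r := a - 1)
        (by linarith)).comp_sub_left t
      convert h using 1 <;> ring
    · refine ContinuousOn.rpow_const (by fun_prop) fun x hx => Or.inl ?_
      rw [uIcc_of_le (by linarith)] at hx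
      linarith [hx.1]

/-- A function on the triangle which is continuous and dominated by `p(s) (r - s)^(a-1)` is
integrable. -/
lemma integrable_indicator_openTriangle {h : ℝ → ℝ → ℝ} {p : ℝ → ℝ} {a t : ℝ} (ha : 0 < a)
    (ht : 0 < t)
    (hc : ContinuousOn (fun q : ℝ × ℝ => h q.1 q.2) (openTriangle t))
    (hb : ∀ r s, 0 < s → s < r → r < t → |h r s| ≤ p s * (r - s) ^ (a - 1))
    (hp : IntervalIntegrable (fun s => p s * (t - s) ^ a) volume 0 t) :
    Integrable ((openTriangle t).indicator (fun q : ℝ × ℝ => h q.1 q.2))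
      ((volume : Measure ℝ).prod volume) := by
  have hm : MeasurableSet (openTriangle t) := (isOpen_openTriangle t).measurableSet
  have hslice : ∀ s, 0 < s →
      (fun r => (openTriangle t).indicator (fun q : ℝ × ℝ => h q.1 q.2) (r, s))
        = (Ioo s t).indicator (fun r => h r s) := by
    intro s hs
    ext r
    simp [indicator, openTriangle, hs]
  have hslice' : ∀ s, ¬ (0 < s ∧ s < t) →
      (fun r => (openTriangle t).indicator (fun q : ℝ × ℝ => h q.1 q.2) (r, s)) = 0 := by
    intro s hs
    ext r
    refine indicator_of_notMem (fun hq => hs ⟨hq.1, hq.2.1.trans hq.2.2⟩) _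
  have hint : ∀ s, 0 < s → s < t → IntegrableOn (fun r => h r s) (Ioo s t) := by
    intro s hs hst
    have hI := (intervalIntegrable_iff_integrableOn_Ioo_of_le hst.le).mp
      ((intervalIntegrable_sub_rpow ha s t).const_mul (p s))
    refine Integrable.mono' hI ?_ ?_
    · refine ContinuousOn.aestronglyMeasurable ?_ measurableSet_Ioo
      exact hc.comp (f := fun r : ℝ => (r, s)) (by fun_prop) fun r hr => ⟨hs, hr.1, hr.2⟩
    · exact ae_restrict_of_forall_mem measurableSet_Ioo fun r hr => hb r s hs hr.1 hr.2
  rw [integrable_prod_iff']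
  · constructor
    · refine Eventually.of_forall fun s => ?_
      by_cases hs : 0 < s ∧ s < t
      · rw [hslice s hs.1]
        exact (hint s hs.1 hs.2).integrable_indicator measurableSet_Ioo
      · rw [hslice' s hs]
        exact integrable_zero _ _ _
    · have hI := ((intervalIntegrable_iff_integrableOn_Ioo_of_le ht.le).mp
        (hp.div_const a)).integrable_indicator measurableSet_Ioo
      refine hI.mono' ?_ (Eventually.of_forall fun s => ?_)
      · refine AEStronglyMeasurable.integral_prod_right' (f := fun q : ℝ × ℝ =>
          ‖(openTriangle t).indicator (fun q : ℝ × ℝ => h q.1 q.2) (q.2, q.1)‖) ?_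
        exact (aestronglyMeasurable_indicator_iff hm |>.mpr
          (hc.aestronglyMeasurable hm)).prod_swap.norm
      · rw [Real.norm_of_nonneg (integral_nonneg fun _ => norm_nonneg _)]
        by_cases hs : 0 < s ∧ s < t
        · rw [indicator_of_mem (show s ∈ Ioo 0 t from hs)]
          have := hslice s hs.1
          have h1 : ∀ r, ‖(openTriangle t).indicator (fun q : ℝ × ℝ => h q.1 q.2) (r, s)‖
              = (Ioo s t).indicator (fun r => ‖h r s‖) r := fun r => by
            rw [congrFun this r, norm_indicator_eq_indicator_norm]
          simp_rw [h1]
          rw [MeasureTheory.integral_indicator measurableSet_Ioo, mul_div_assoc, ← integral_sub_rpow ha,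
            ← intervalIntegral.integral_const_mul, intervalIntegral_eq_Ioo hs.2.le]
          refine setIntegral_mono_on (hint s hs.1 hs.2).norm
            ((intervalIntegrable_iff_integrableOn_Ioo_of_le hs.2.le).mp
              ((intervalIntegrable_sub_rpow ha s t).const_mul (p s))) measurableSet_Ioo ?_
          exact fun r hr => hb r s hs.1 hr.1 hr.2
        · rw [indicator_of_notMem (show s ∉ Ioo 0 t from hs)]
          have h1 : ∀ r, (openTriangle t).indicator (fun q : ℝ × ℝ => h q.1 q.2) (r, s) = 0 :=
            fun r => congrFun (hslice' s hs) r
          simp [h1]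
  · exact aestronglyMeasurable_indicator_iff hm |>.mpr (hc.aestronglyMeasurable hm)

/-- Fubini's theorem on a triangle, together with integrability of the inner integral. -/
lemma integral_integral_swap_openTriangle {h : ℝ → ℝ → ℝ} {t : ℝ} (ht : 0 < t)
    (hi : Integrable ((openTriangle t).indicator (fun q : ℝ × ℝ => h q.1 q.2))
      ((volume : Measure ℝ).prod volume)) :
    IntervalIntegrable (fun r => ∫ s in (0 : ℝ)..r, h r s) volume 0 t ∧
    ∫ s in (0 : ℝ)..t, ∫ r in s..t, h r s = ∫ r in (0 : ℝ)..t, ∫ s in (0 : ℝ)..r, h r s := by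
  have hrow : ∀ s, (∫ r, (openTriangle t).indicator (fun q : ℝ × ℝ => h q.1 q.2) (r, s))
      = (Ioo 0 t).indicator (fun s => ∫ r in s..t, h r s) s := by
    intro s
    by_cases hs : s ∈ Ioo 0 t
    · rw [indicator_of_mem hs, intervalIntegral_eq_Ioo hs.2.le,
        ← MeasureTheory.integral_indicator measurableSet_Ioo]
      congr 1
      ext r
      simp [indicator, openTriangle, hs.1]
    · rw [indicator_of_notMem hs]
      refine integral_eq_zero_of_ae (Eventually.of_forall fun r => ?_)
      exact indicator_of_notMem (fun hq => hs ⟨hq.1, hq.2.1.trans hq.2.2⟩) _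
  have hcol : ∀ r, (∫ s, (openTriangle t).indicator (fun q : ℝ × ℝ => h q.1 q.2) (r, s))
      = (Ioo 0 t).indicator (fun r => ∫ s in (0 : ℝ)..r, h r s) r := by
    intro r
    by_cases hr : r ∈ Ioo 0 t
    · rw [indicator_of_mem hr, intervalIntegral_eq_Ioo hr.1.le,
        ← MeasureTheory.integral_indicator measurableSet_Ioo]
      congr 1
      ext s
      simp [indicator, openTriangle, hr.2]
    · rw [indicator_of_notMem hr]
      refine integral_eq_zero_of_ae (Eventually.of_forall fun s => ?_)
      exact indicator_of_notMem (fun hq => hr ⟨hq.1.trans hq.2.1, hq.2.2⟩) _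
  constructor
  · have h1 := hi.integral_prod_left
    simp_rw [hcol] at h1
    rw [intervalIntegrable_iff_integrableOn_Ioc_of_le ht.le, integrableOn_Ioc_iff_integrableOn_Ioo]
    exact (integrable_indicator_iff measurableSet_Ioo).mp h1
  · have h1 := integral_integral_swap
      (f := fun r s => (openTriangle t).indicator (fun q : ℝ × ℝ => h q.1 q.2) (r, s)) hi
    simp_rw [hrow, hcol] at h1
    rw [MeasureTheory.integral_indicator measurableSet_Ioo, MeasureTheory.integral_indicator measurableSet_Ioo] at h1
    rw [intervalIntegral_eq_Ioo ht.le, intervalIntegral_eq_Ioo ht.le, h1]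

/-- Continuity of `r ↦ ∫_0^r H(r,s) ds` for a kernel with integrable singularities on the boundary
of the triangle. -/
lemma continuousAt_integral_openTriangle {H : ℝ → ℝ → ℝ} {C a b T : ℝ} (ha : 0 < a) (hb1 : b < 1)
    (hc : ContinuousOn (fun q : ℝ × ℝ => H q.1 q.2) (openTriangle T))
    (hb : ∀ r s, 0 < s → s < r → r < T → |H r s| ≤ C * (r - s) ^ (a - 1) * s ^ (-b))
    {t : ℝ} (ht : t ∈ Ioo 0 T) :
    ContinuousAt (fun r => ∫ s in (0 : ℝ)..r, H r s) t := by
  have hscale : (fun r => ∫ s in (0 : ℝ)..r, H r s)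
      = fun r => r * ∫ y in (0 : ℝ)..1, H r (r * y) := by
    ext r
    simp
  rw [hscale]
  refine continuousAt_id.mul ?_
  have hnhds : ∀ᶠ r in 𝓝 t, r ∈ Ioo 0 T := isOpen_Ioo.mem_nhds ht
  have hmem : ∀ {r y : ℝ}, r ∈ Ioo 0 T → y ∈ Ioo (0 : ℝ) 1 → (r, r * y) ∈ openTriangle T :=
    fun hr hy => ⟨mul_pos hr.1 hy.1, mul_lt_of_lt_one_right hr.1 hy.2, hr.2⟩
  have hev : ∀ᶠ r in 𝓝 t, |C| * r ^ (a - 1) * r ^ (-b) < |C| * t ^ (a - 1) * t ^ (-b) + 1 := by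
    have : ContinuousAt (fun r : ℝ => |C| * r ^ (a - 1) * r ^ (-b)) t :=
      (continuousAt_const.mul (continuousAt_id.rpow_const (Or.inl ht.1.ne'))).mul
        (continuousAt_id.rpow_const (Or.inl ht.1.ne'))
    exact this.eventually (gt_mem_nhds (by simp))
  refine continuousAt_of_dominated_interval
    (bound := fun y => (|C| * t ^ (a - 1) * t ^ (-b) + 1) * ((1 - y) ^ (a - 1) * y ^ (-b))) ?_ ?_
    ((intervalIntegrable_beta ha hb1 one_pos).const_mul _) ?_
  · filter_upwards [hnhds] with r hr
    rw [uIoc_of_le zero_le_one, ← restrict_Ioo_eq_restrict_Ioc]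
    refine ContinuousOn.aestronglyMeasurable ?_ measurableSet_Ioo
    exact hc.comp (f := fun y : ℝ => (r, r * y)) (by fun_prop) fun y hy => hmem hr hy
  · filter_upwards [hnhds, hev] with r hr hev
    refine ae_uIoc_of_forall_Ioo zero_le_one fun y hy => ?_
    have h1 := hmem hr hy
    have hy1 : 0 < 1 - y := by linarith [hy.2]
    have hpos : 0 ≤ (1 - y) ^ (a - 1) * y ^ (-b) :=
      mul_nonneg (rpow_nonneg hy1.le _) (rpow_nonneg hy.1.le _)
    calc ‖H r (r * y)‖ ≤ C * (r - r * y) ^ (a - 1) * (r * y) ^ (-b) := hb _ _ h1.1 h1.2.1 h1.2.2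
      _ = C * r ^ (a - 1) * r ^ (-b) * ((1 - y) ^ (a - 1) * y ^ (-b)) := by
        rw [show r - r * y = r * (1 - y) by ring, mul_rpow hr.1.le hy1.le,
          mul_rpow hr.1.le hy.1.le]
        ring
      _ ≤ |C| * r ^ (a - 1) * r ^ (-b) * ((1 - y) ^ (a - 1) * y ^ (-b)) := by
        have := rpow_nonneg hr.1.le (a - 1)
        have := rpow_nonneg hr.1.le (-b)
        gcongr
        exact le_abs_self C
      _ ≤ _ := by gcongr
  · refine ae_uIoc_of_forall_Ioo zero_le_one fun y hy => ?_
    have h1 : ContinuousAt (fun q : ℝ × ℝ => H q.1 q.2) (t, t * y) :=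
      hc.continuousAt ((isOpen_openTriangle T).mem_nhds (hmem ht hy))
    exact ContinuousAt.comp (f := fun r : ℝ => (r, r * y)) h1 (by fun_prop)

section SingularKernel

variable {f : ℝ → ℝ → ℝ} {C a b T : ℝ}

lemma intervalIntegrable_singularKernel (ha : 0 < a)
    (hc : ContinuousOn (fun q : ℝ × ℝ => f q.1 q.2) (openTriangle T))
    (hf : ∀ r s, 0 < s → s < r → r < T → |f r s| ≤ C * (r - s) ^ (a - 1) * s ^ (-b))
    {r s : ℝ} (hs : 0 < s) (hsr : s ≤ r) (hr : r < T) :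
    IntervalIntegrable (fun u => f u s) volume s r := by
  rw [intervalIntegrable_iff_integrableOn_Ioc_of_le hsr, integrableOn_Ioc_iff_integrableOn_Ioo]
  have hI := (intervalIntegrable_iff_integrableOn_Ioo_of_le hsr).mp
    (((intervalIntegrable_sub_rpow ha s r).const_mul C).mul_const (s ^ (-b)))
  refine Integrable.mono' hI ?_ ?_
  · refine ContinuousOn.aestronglyMeasurable ?_ measurableSet_Ioo
    exact hc.comp (f := fun u : ℝ => (u, s)) (by fun_prop)
      fun u hu => ⟨hs, hu.1, hu.2.trans hr⟩
  · exact ae_restrict_of_forall_mem measurableSet_Ioo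
      fun u hu => hf u s hs hu.1 (hu.2.trans hr)

lemma abs_integral_singularKernel_le (ha : 0 < a)
    (hf : ∀ r s, 0 < s → s < r → r < T → |f r s| ≤ C * (r - s) ^ (a - 1) * s ^ (-b))
    {r s : ℝ} (hs : 0 < s) (hsr : s ≤ r) (hr : r < T) :
    |∫ u in s..r, f u s| ≤ C * s ^ (-b) * ((r - s) ^ a / a) := by
  have hI := ((intervalIntegrable_sub_rpow ha s r).const_mul (C * s ^ (-b)))
  rw [← integral_sub_rpow ha, ← intervalIntegral.integral_const_mul]
  have h := ae_uIoc_of_forall_Ioo hsr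
    (p := fun u => ‖f u s‖ ≤ C * s ^ (-b) * (u - s) ^ (a - 1)) fun u hu => by
      have := hf u s hs hu.1 (hu.2.trans hr)
      rw [Real.norm_eq_abs]
      linarith
  rw [uIoc_of_le hsr] at h
  exact intervalIntegral.norm_integral_le_of_norm_le (f := fun u => f u s) hsr h hI

lemma continuousOn_integral_singularKernel (ha : 0 < a) (hC : 0 ≤ C)
    (hc : ContinuousOn (fun q : ℝ × ℝ => f q.1 q.2) (openTriangle T))
    (hf : ∀ r s, 0 < s → s < r → r < T → |f r s| ≤ C * (r - s) ^ (a - 1) * s ^ (-b)) :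
    ContinuousOn (fun q : ℝ × ℝ => ∫ u in q.2..q.1, f u q.2) (openTriangle T) := by
  have hscale : (fun q : ℝ × ℝ => ∫ u in q.2..q.1, f u q.2)
      = fun q => (q.1 - q.2) * ∫ y in (0 : ℝ)..1, f (q.2 + (q.1 - q.2) * y) q.2 := by
    ext q
    have := smul_integral_comp_add_mul (a := 0) (b := 1) (fun u => f u q.2) (q.1 - q.2) q.2
    simpa using this.symm
  rw [hscale]
  intro q₀ hq₀
  refine ContinuousAt.continuousWithinAt (ContinuousAt.mul (by fun_prop) ?_)
  have hnhds : ∀ᶠ q in 𝓝 q₀, q ∈ openTriangle T := (isOpen_openTriangle T).mem_nhds hq₀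
  have hmem : ∀ {q : ℝ × ℝ} {y : ℝ}, q ∈ openTriangle T → y ∈ Ioo (0 : ℝ) 1 →
      (q.2 + (q.1 - q.2) * y, q.2) ∈ openTriangle T := by
    intro q y hq hy
    have h1 : 0 < q.1 - q.2 := sub_pos.mpr hq.2.1
    have h2 := mul_pos h1 hy.1
    have h3 := mul_lt_of_lt_one_right h1 hy.2
    have h4 := hq.2.2
    exact ⟨hq.1, by simp only; linarith, by simp only; linarith⟩
  have hev : ∀ᶠ q : ℝ × ℝ in 𝓝 q₀, C * (q.1 - q.2) ^ (a - 1) * q.2 ^ (-b)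
      < C * (q₀.1 - q₀.2) ^ (a - 1) * q₀.2 ^ (-b) + 1 := by
    have : ContinuousAt (fun q : ℝ × ℝ => C * (q.1 - q.2) ^ (a - 1) * q.2 ^ (-b)) q₀ := by
      have h1 : ContinuousAt (fun q : ℝ × ℝ => (q.1 - q.2) ^ (a - 1)) q₀ :=
        ContinuousAt.rpow_const (by fun_prop) (Or.inl (sub_pos.mpr hq₀.2.1).ne')
      have h2 : ContinuousAt (fun q : ℝ × ℝ => q.2 ^ (-b)) q₀ :=
        continuousAt_snd.rpow_const (Or.inl hq₀.1.ne')
      exact (continuousAt_const.mul h1).mul h2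
    exact this.eventually (gt_mem_nhds (by simp))
  have hbi : IntervalIntegrable (fun y : ℝ => y ^ (a - 1)) volume 0 1 :=
    intervalIntegrable_rpow' (by linarith)
  refine continuousAt_of_dominated_interval
    (bound := fun y => (C * (q₀.1 - q₀.2) ^ (a - 1) * q₀.2 ^ (-b) + 1) * y ^ (a - 1)) ?_ ?_
    (hbi.const_mul _) ?_
  · filter_upwards [hnhds] with q hq
    rw [uIoc_of_le zero_le_one, ← restrict_Ioo_eq_restrict_Ioc]
    refine ContinuousOn.aestronglyMeasurable ?_ measurableSet_Ioo
    exact hc.comp (f := fun y : ℝ => (q.2 + (q.1 - q.2) * y, q.2)) (by fun_prop)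
      fun y hy => hmem hq hy
  · filter_upwards [hnhds, hev] with q hq hev
    refine ae_uIoc_of_forall_Ioo zero_le_one fun y hy => ?_
    have h1 := hmem hq hy
    have hpos : 0 ≤ y ^ (a - 1) := rpow_nonneg hy.1.le _
    calc ‖f (q.2 + (q.1 - q.2) * y) q.2‖
        ≤ C * (q.2 + (q.1 - q.2) * y - q.2) ^ (a - 1) * q.2 ^ (-b) := hf _ _ h1.1 h1.2.1 h1.2.2
      _ = C * (q.1 - q.2) ^ (a - 1) * q.2 ^ (-b) * y ^ (a - 1) := by
        rw [add_sub_cancel_left, mul_rpow (sub_pos.mpr hq.2.1).le hy.1.le]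
        ring
      _ ≤ _ := by gcongr
  · refine ae_uIoc_of_forall_Ioo zero_le_one fun y hy => ?_
    have h1 : ContinuousAt (fun q : ℝ × ℝ => f q.1 q.2) (q₀.2 + (q₀.1 - q₀.2) * y, q₀.2) :=
      hc.continuousAt ((isOpen_openTriangle T).mem_nhds (hmem hq₀ hy))
    exact ContinuousAt.comp (f := fun q : ℝ × ℝ => (q.2 + (q.1 - q.2) * y, q.2)) h1 (by fun_prop)

lemma sq_integral_singularKernel (ha : 0 < a)
    (hc : ContinuousOn (fun q : ℝ × ℝ => f q.1 q.2) (openTriangle T))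
    (hf : ∀ r s, 0 < s → s < r → r < T → |f r s| ≤ C * (r - s) ^ (a - 1) * s ^ (-b))
    {r s : ℝ} (hs : 0 < s) (hsr : s ≤ r) (hr : r < T) :
    (∫ u in s..r, f u s) ^ 2 = ∫ v in s..r, 2 * (∫ u in s..v, f u s) * f v s := by
  have hI := intervalIntegrable_singularKernel ha hc hf hs hsr hr
  have hP : ContinuousOn (fun v => ∫ u in s..v, f u s) (uIcc s r) :=
    continuousOn_primitive_interval' hI left_mem_uIcc
  rw [integral_eq_sub_of_hasDerivAt_of_le (f := fun v => (∫ u in s..v, f u s) ^ 2)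
    (f' := fun v => 2 * (∫ u in s..v, f u s) * f v s) hsr]
  · simp
  · rw [uIcc_of_le hsr] at hP
    exact hP.pow 2
  · intro v hv
    have hcs : ContinuousOn (fun u => f u s) (Ioo s T) :=
      hc.comp (f := fun u : ℝ => (u, s)) (by fun_prop) fun u hu => ⟨hs, hu.1, hu.2⟩
    have hv' : v ∈ Ioo s T := ⟨hv.1, hv.2.trans hr⟩
    have h := integral_hasDerivAt_right
      (intervalIntegrable_singularKernel ha hc hf hs hv.1.le hv'.2)
      (hcs.stronglyMeasurableAtFilter isOpen_Ioo v hv')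
      (hcs.continuousAt (isOpen_Ioo.mem_nhds hv'))
    simpa using h.fun_pow 2
  · exact hI.continuousOn_mul (continuousOn_const.mul hP)

lemma intervalIntegrable_rpow_mul_rpow_two (ha : 0 < a) (hb : b < 1 / 2) (D : ℝ) {t : ℝ}
    (ht : 0 < t) :
    IntervalIntegrable (fun s => D * ((t - s) ^ (2 * a - 1) * s ^ (-(2 * b)))) volume 0 t :=
  (intervalIntegrable_beta (by linarith) (by linarith) ht).const_mul D

lemma abs_two_mul_integral_mul_singularKernel_le (ha : 0 < a) (hC : 0 ≤ C)
    (hf : ∀ r s, 0 < s → s < r → r < T → |f r s| ≤ C * (r - s) ^ (a - 1) * s ^ (-b))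
    {r s : ℝ} (hs : 0 < s) (hsr : s < r) (hr : r < T) :
    |2 * (∫ u in s..r, f u s) * f r s|
      ≤ 2 * C ^ 2 / a * (r - s) ^ (2 * a - 1) * s ^ (-(2 * b)) := by
  have h1 := abs_integral_singularKernel_le ha hf hs hsr.le hr
  have h2 := hf r s hs hsr hr
  have h3 : 0 < r - s := sub_pos.mpr hsr
  rw [abs_mul, abs_mul, abs_two, show 2 * a - 1 = a + (a - 1) by ring, rpow_add h3,
    show -(2 * b) = -b + -b by ring, rpow_add hs]
  have := rpow_nonneg h3.le a
  have := rpow_nonneg hs.le (-b)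
  calc _ ≤ 2 * (C * s ^ (-b) * ((r - s) ^ a / a)) * (C * (r - s) ^ (a - 1) * s ^ (-b)) := by
        gcongr
    _ = _ := by ring

/-- The energy `∫_0^τ (∫_s^τ f(r,s) dr)² ds` is differentiable when `f` has integrable
singularities on the boundary of the triangle. -/
lemma hasDerivAt_energy_singularKernel (ha : 0 < a) (hb : b < 1 / 2) (hC : 0 ≤ C)
    (hc : ContinuousOn (fun q : ℝ × ℝ => f q.1 q.2) (openTriangle T))
    (hf : ∀ r s, 0 < s → s < r → r < T → |f r s| ≤ C * (r - s) ^ (a - 1) * s ^ (-b))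
    {t : ℝ} (ht : t ∈ Ioo 0 T) :
    HasDerivAt (fun τ => ∫ s in (0 : ℝ)..τ, (∫ r in s..τ, f r s) ^ 2)
      (∫ s in (0 : ℝ)..t, 2 * (∫ r in s..t, f r s) * f t s) t := by
  have hHc : ContinuousOn (fun q : ℝ × ℝ => 2 * (∫ u in q.2..q.1, f u q.2) * f q.1 q.2)
      (openTriangle T) :=
    (continuousOn_const.mul (continuousOn_integral_singularKernel ha hC hc hf)).mul hc
  have hHb : ∀ r s, 0 < s → s < r → r < T → |2 * (∫ u in s..r, f u s) * f r s|
      ≤ 2 * C ^ 2 / a * (r - s) ^ (2 * a - 1) * s ^ (-(2 * b)) :=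
    fun r s hs hsr hr => abs_two_mul_integral_mul_singularKernel_le ha hC hf hs hsr hr
  have hGc : ∀ τ ∈ Ioo 0 T,
      ContinuousAt (fun r => ∫ s in (0 : ℝ)..r, 2 * (∫ u in s..r, f u s) * f r s) τ :=
    fun τ hτ => continuousAt_integral_openTriangle (by linarith) (by linarith) hHc hHb hτ
  have hswap : ∀ τ ∈ Ioo 0 T, _ := fun τ hτ =>
    integral_integral_swap_openTriangle (h := fun r s => 2 * (∫ u in s..r, f u s) * f r s) hτ.1
    (integrable_indicator_openTriangle (p := fun s => 2 * C ^ 2 / a * s ^ (-(2 * b)))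
      (a := 2 * a) (by linarith) hτ.1 (hHc.mono (openTriangle_mono hτ.2.le))
      (fun r s hs hsr hr => (hHb r s hs hsr (hr.trans hτ.2)).trans_eq (by ring)) (by
        have hI := ((intervalIntegrable_rpow_mul_rpow_two ha hb (2 * C ^ 2 / a) hτ.1)
          ).continuousOn_mul (g := fun s => τ - s) (by fun_prop)
        refine hI.congr_ae ?_
        rw [uIoc_of_le hτ.1.le, ← restrict_Ioo_eq_restrict_Ioc]
        refine ae_restrict_of_forall_mem measurableSet_Ioo fun s hs => ?_
        have : 0 < τ - s := sub_pos.mpr hs.2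
        have h2 : (τ - s) ^ (2 * a) = (τ - s) * (τ - s) ^ (2 * a - 1) := by
          rw [rpow_sub_one this.ne']
          field_simp
        simp only [h2]
        ring))
  have hV : (fun τ => ∫ s in (0 : ℝ)..τ, (∫ r in s..τ, f r s) ^ 2) =ᶠ[𝓝 t]
      fun τ => ∫ r in (0 : ℝ)..τ, ∫ s in (0 : ℝ)..r, 2 * (∫ u in s..r, f u s) * f r s := by
    filter_upwards [isOpen_Ioo.mem_nhds ht] with τ hτ
    rw [← (hswap τ hτ).2]
    exact intervalIntegral.integral_congr_ae (ae_uIoc_of_forall_Ioo hτ.1.le fun s hs =>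
      sq_integral_singularKernel ha hc hf hs.1 hs.2.le hτ.2)
  refine HasDerivAt.congr_of_eventuallyEq ?_ hV
  exact integral_hasDerivAt_right (hswap t ht).1
    (ContinuousOn.stronglyMeasurableAtFilter isOpen_Ioo
      (fun τ hτ => (hGc τ hτ).continuousWithinAt) t ht) (hGc t ht)

lemma integral_integral_mul_singularKernel (ha : 0 < a) (hb : b < 1 / 2)
    (hC : 0 ≤ C)
    (hc : ContinuousOn (fun q : ℝ × ℝ => f q.1 q.2) (openTriangle T))
    (hf : ∀ r s, 0 < s → s < r → r < T → |f r s| ≤ C * (r - s) ^ (a - 1) * s ^ (-b))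
    {t : ℝ} (ht : t ∈ Ioo 0 T) :
    ∫ s in (0 : ℝ)..t, 2 * (∫ r in s..t, f r s) * f t s
      = ∫ u in (0 : ℝ)..t, ∫ s in (0 : ℝ)..u, 2 * f u s * f t s := by
  have hcont : ContinuousOn (fun q : ℝ × ℝ => 2 * f q.1 q.2 * f t q.2) (openTriangle t) := by
    refine (continuousOn_const.mul (hc.mono (openTriangle_mono ht.2.le))).mul ?_
    exact hc.comp (f := fun q : ℝ × ℝ => (t, q.2)) (by fun_prop)
      fun q hq => ⟨hq.1, hq.2.1.trans hq.2.2, ht.2⟩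
  have hI := integrable_indicator_openTriangle (h := fun u s => 2 * f u s * f t s)
    (p := fun s => 2 * C ^ 2 * (t - s) ^ (a - 1) * s ^ (-(2 * b))) ha ht.1 hcont
    (fun u s hs hsu hu => by
      have h1 := hf u s hs hsu (hu.trans ht.2)
      have h2 := hf t s hs (hsu.trans hu) ht.2
      have h3 : 0 ≤ (u - s) ^ (a - 1) := rpow_nonneg (sub_pos.mpr hsu).le _
      have h4 := rpow_nonneg hs.le (-b)
      rw [abs_mul, abs_mul, abs_two, show -(2 * b) = -b + -b by ring, rpow_add hs]
      calc _ ≤ 2 * (C * (u - s) ^ (a - 1) * s ^ (-b)) * (C * (t - s) ^ (a - 1) * s ^ (-b)) := by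
            gcongr
        _ = _ := by ring)
    (by
      refine (intervalIntegrable_rpow_mul_rpow_two ha hb (2 * C ^ 2) ht.1).congr_ae ?_
      rw [uIoc_of_le ht.1.le, ← restrict_Ioo_eq_restrict_Ioc]
      refine ae_restrict_of_forall_mem measurableSet_Ioo fun s hs => ?_
      simp only
      rw [show 2 * a - 1 = a + (a - 1) by ring, rpow_add (sub_pos.mpr hs.2)]
      ring)
  rw [← (integral_integral_swap_openTriangle ht.1 hI).2]
  congr 1
  ext s
  rw [intervalIntegral.integral_mul_const, intervalIntegral.integral_const_mul]

end SingularKernel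

/-- If moreover `σ` is continuous on `[0,T]`, then
`V(t) = ∫_0^t (∫_s^t σ_r K'(r,s) dr)² ds` is differentiable on `(0,T)` with
`V'(t) = 2 σ_t ∫_0^t σ_u φ(t,u) du`, where `φ(t,u) = ∫_0^{min(t,u)} K'(t,v) K'(u,v) dv`. -/
theorem volterra_variance_derivative
    (T : ℝ) (hT : 0 < T) (K K' : ℝ → ℝ → ℝ)
    (hVol : ∀ t s : ℝ, t < s → K t s = 0)
    (hKcont : ContinuousOn (fun p : ℝ × ℝ => K p.1 p.2)
      {p : ℝ × ℝ | 0 < p.2 ∧ p.2 ≤ p.1 ∧ p.1 < T})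
    (hK' : ∀ s t : ℝ, 0 < s → s < t → t < T → HasDerivAt (fun τ => K τ s) (K' t s) t)
    (hK'cont : ContinuousOn (fun p : ℝ × ℝ => K' p.1 p.2)
      {p : ℝ × ℝ | 0 < p.2 ∧ p.2 < p.1 ∧ p.1 < T})
    (α β c : ℝ) (hα : 0 < α) (hα' : α < 1 / 2) (hβ : 0 < β) (hβ' : β < 1 / 2)
    (hc : 0 < c)
    (hH2 : ∀ s t : ℝ, 0 < s → s < t → t < T →
      |K' t s| ≤ c * (t - s) ^ (α - 1) * (t / s) ^ β)
    (σ : ℝ → ℝ) (hσmeas : Measurable σ)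
    (Cσ : ℝ) (hσB : ∀ t ∈ Set.Icc (0 : ℝ) T, |σ t| ≤ Cσ)
    (hσcont : ContinuousOn σ (Set.Icc (0 : ℝ) T)) :
    ∀ t ∈ Set.Ioo (0 : ℝ) T,
      HasDerivAt (fun τ => ∫ s in (0 : ℝ)..τ, (∫ r in s..τ, σ r * K' r s) ^ 2)
        (2 * σ t * ∫ u in (0 : ℝ)..t, σ u * ∫ w in (0 : ℝ)..(min t u), K' t w * K' u w) t := by
  intro t ht
  have hCσ : 0 ≤ Cσ := (abs_nonneg _).trans (hσB 0 ⟨le_rfl, hT.le⟩)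
  have hc' : ContinuousOn (fun q : ℝ × ℝ => σ q.1 * K' q.1 q.2) (openTriangle T) := by
    refine ContinuousOn.mul ?_ hK'cont
    exact hσcont.comp continuousOn_fst fun q hq => ⟨(hq.1.trans hq.2.1).le, hq.2.2.le⟩
  have hf : ∀ r s, 0 < s → s < r → r < T →
      |σ r * K' r s| ≤ Cσ * c * T ^ β * (r - s) ^ (α - 1) * s ^ (-β) := by
    intro r s hs hsr hr
    have h1 := hσB r ⟨(hs.trans hsr).le, hr.le⟩
    have h2 := hH2 s r hs hsr hr
    have hr0 : 0 < r := hs.trans hsr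
    have h3 : (r / s) ^ β ≤ T ^ β * s ^ (-β) := by
      rw [div_rpow hr0.le hs.le, rpow_neg hs.le, div_eq_mul_inv]
      have := rpow_nonneg hs.le β
      gcongr
    have h4 : 0 ≤ (r - s) ^ (α - 1) := rpow_nonneg (sub_pos.mpr hsr).le _
    rw [abs_mul]
    calc |σ r| * |K' r s| ≤ Cσ * (c * (r - s) ^ (α - 1) * (T ^ β * s ^ (-β))) := by
          gcongr
          exact h2.trans (by gcongr)
      _ = _ := by ring
  have hC : 0 ≤ Cσ * c * T ^ β := by positivity
  have hderiv := hasDerivAt_energy_singularKernel hα hβ' hC hc' hf ht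
  rw [integral_integral_mul_singularKernel hα hβ' hC hc' hf ht] at hderiv
  convert hderiv using 1
  rw [← intervalIntegral.integral_const_mul]
  refine intervalIntegral.integral_congr fun u hu => ?_
  rw [uIcc_of_le ht.1.le] at hu
  simp only [min_eq_right hu.2]
  rw [← intervalIntegral.integral_const_mul, ← intervalIntegral.integral_const_mul]
  congr 1
  ext w
  ring
end
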